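/- arXiv:1902.03730 — 4 statements merged into one kernel-verified Lean document; each statement's English description precedes it below -/
import Mathlib

section
/- Let P = conv(v_0, …, v_d) ⊂ ℝ^d be a very ample lattice d-simplex containing exactly one lattice point u besides its vertices, i.e., P ∩ M = {v_0, …, v_d, u} and |P ∩ M| = d + 2. Then P is normal: for every k ≥ 1, every lattice point of kP is a sum of k lattice points of P. -/
open Set MeasureTheory
open scoped Pointwise

/-- A point of `ℝ^n` is a lattice point if all its coordinates are integers. -/
def IsLatticePt {n : ℕ} (x : Fin n → ℝ) : Prop := ∀ i, ∃ z : ℤ, x i = (z : ℝ)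

/-- The set of lattice points of a subset of `ℝ^n`. -/
def latticePts {n : ℕ} (S : Set (Fin n → ℝ)) : Set (Fin n → ℝ) := {x ∈ S | IsLatticePt x}

/-- `P` is `k`-normal: every lattice point of the dilate `k • P` is a sum of `k`
lattice points of `P`. -/
def IsKNormal {n : ℕ} (P : Set (Fin n → ℝ)) (k : ℕ) : Prop :=
  ∀ x ∈ latticePts ((k : ℝ) • P),
    ∃ u : Fin k → Fin n → ℝ, (∀ j, u j ∈ latticePts P) ∧ x = ∑ j, u j

/-- The `k`-normality `k_P`: the least positive integer such that `P` is `k`-normal for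
all `k ≥ k_P`. -/
noncomputable def kNormality {n : ℕ} (P : Set (Fin n → ℝ)) : ℕ :=
  sInf {m | 0 < m ∧ ∀ k, m ≤ k → IsKNormal P k}

/-- The real cone generated by a set `S` (for convex `S`, all nonnegative multiples of
points of `S`). -/
def coneOver {n : ℕ} (S : Set (Fin n → ℝ)) : Set (Fin n → ℝ) :=
  {x | ∃ t : ℝ, ∃ p ∈ S, 0 ≤ t ∧ x = t • p}

/-- `P` is very ample: for every vertex (= extreme point) `v` of `P`, every lattice point
of the real cone generated by `P - v` is a finite sum of elements of `(P ∩ M) - v`. -/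
def IsVeryAmple {n : ℕ} (P : Set (Fin n → ℝ)) : Prop :=
  ∀ v ∈ P.extremePoints ℝ, ∀ x : Fin n → ℝ, IsLatticePt x →
    x ∈ coneOver ((fun p => p - v) '' P) →
    ∃ (m : ℕ) (u : Fin m → Fin n → ℝ), (∀ j, u j ∈ latticePts P) ∧ x = ∑ j, (u j - v)

/-- The invariant `d_P`: the smallest positive integer such that
`(k+1)P ∩ M = (P ∩ M) + (kP ∩ M)` for all `k ≥ d_P`. -/
noncomputable def dInv {n : ℕ} (P : Set (Fin n → ℝ)) : ℕ :=
  sInf {m | 0 < m ∧ ∀ k : ℕ, m ≤ k →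
    latticePts (((k : ℝ) + 1) • P) = latticePts P + latticePts ((k : ℝ) • P)}

/-- The invariant `ν_P` (relative to a set `V`, typically the vertex set of `P`): the
smallest positive integer such that `(k+1)P ∩ M = V + (kP ∩ M)` for all `k ≥ ν_P`. -/
noncomputable def nuInv {n : ℕ} (V P : Set (Fin n → ℝ)) : ℕ :=
  sInf {m | 0 < m ∧ ∀ k : ℕ, m ≤ k →
    latticePts (((k : ℝ) + 1) • P) = V + latticePts ((k : ℝ) • P)}

/-- The normalized volume of `P ⊆ ℝ^n`: `n!` times its Euclidean (Lebesgue) volume. -/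
noncomputable def nVol {n : ℕ} (P : Set (Fin n → ℝ)) : ℝ :=
  (n.factorial : ℝ) * (volume P).toReal

open Classical in
/-- The degree of a lattice `n`-polytope `P`: `n` if `P` has an interior lattice point,
and otherwise the least `i ≥ 0` such that `(kP)° ∩ M = ∅` for all `1 ≤ k ≤ n - i`. -/
noncomputable def polyDeg {n : ℕ} (P : Set (Fin n → ℝ)) : ℕ :=
  if (latticePts (interior P)).Nonempty then n
  else sInf {i | ∀ k : ℕ, 1 ≤ k → k ≤ n - i → latticePts (interior ((k : ℝ) • P)) = ∅}

/-- A sum of `M` elements of `insert u (Set.range v)` is a combination of `u` and the `v i` with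
natural coefficients adding up to `M`. -/
theorem sum_eq_smul_add_sum_smul {ι E : Type*} [Fintype ι] [AddCommGroup E] [Module ℝ E]
    (v : ι → E) (u : E) {M : ℕ} (w : Fin M → E) (hw : ∀ j, w j ∈ insert u (Set.range v)) :
    ∃ (m : ℕ) (n : ι → ℕ), m + ∑ i, n i = M ∧
      ∑ j, w j = (m : ℝ) • u + ∑ i, (n i : ℝ) • v i := by
  classical
  induction M with
  | zero => exact ⟨0, 0, by simp, by simp⟩
  | succ M ih =>
    obtain ⟨m, n, hmn, hsum⟩ := ih (fun j => w j.castSucc) (fun j => hw _)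
    rw [Fin.sum_univ_castSucc, hsum]
    rcases hw (Fin.last M) with h | ⟨i, h⟩
    · refine ⟨m + 1, n, by omega, ?_⟩
      rw [h]
      push_cast
      module
    · refine ⟨m, n + Pi.single i 1, ?_, ?_⟩
      · simp [Finset.sum_add_distrib]
        omega
      · have : ∑ l, ((n + Pi.single i 1 : ι → ℕ) l : ℝ) • v l = ∑ l, (n l : ℝ) • v l + v i := by
          simp [add_smul, Finset.sum_add_distrib, Pi.single_apply]
        rw [this, ← h, add_assoc]

/-- A combination of `u` and the `v i` with natural coefficients adding up to `k` is a sum of `k`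
elements of `insert u (Set.range v)`. -/
theorem exists_sum_eq_smul_add_sum_smul {ι E : Type*} [Fintype ι] [AddCommGroup E] [Module ℝ E]
    (v : ι → E) (u : E) {k m : ℕ} (n : ι → ℕ) (hk : m + ∑ i, n i = k) :
    ∃ w : Fin k → E, (∀ j, w j ∈ insert u (Set.range v)) ∧
      (m : ℝ) • u + ∑ i, (n i : ℝ) • v i = ∑ j, w j := by
  let e : Fin k ≃ Fin m ⊕ (Σ i, Fin (n i)) := Fintype.equivOfCardEq (by simp [hk])
  refine ⟨fun j => Sum.elim (fun _ => u) (fun p => v p.1) (e j), fun j => ?_, ?_⟩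
  · rcases h : e j with _ | p <;> simp [h]
  · rw [e.sum_comp (Sum.elim (fun _ => u) (fun p => v p.1))]
    simp [Fintype.sum_sum_type, Fintype.sum_sigma, Nat.cast_smul_eq_nsmul]

theorem IsLatticePt.sub_natCast_smul {n : ℕ} {x y : Fin n → ℝ} (hx : IsLatticePt x)
    (hy : IsLatticePt y) (k : ℕ) : IsLatticePt (x - (k : ℝ) • y) := by
  intro i
  obtain ⟨a, ha⟩ := hx i
  obtain ⟨b, hb⟩ := hy i
  exact ⟨a - k * b, by simp [ha, hb]⟩

theorem exists_weights_of_mem_convexHull_range {ι E : Type*} [Fintype ι] [AddCommGroup E]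
    [Module ℝ E] {v : ι → E} {x : E} (hx : x ∈ convexHull ℝ (Set.range v)) :
    ∃ w : ι → ℝ, (∀ i, 0 ≤ w i) ∧ ∑ i, w i = 1 ∧ ∑ i, w i • v i = x := by
  classical
  have h : Set.range v = Fintype.linearCombination ℝ v '' Set.range fun i : ι => Pi.single i 1 := by
    rw [← Set.range_comp]
    congr 1
    ext i
    simp [Fintype.linearCombination_apply_single]
  rw [h, ← LinearMap.image_convexHull, convexHull_rangle_single_eq_stdSimplex] at hx
  obtain ⟨w, ⟨hw0, hw1⟩, rfl⟩ := hx
  exact ⟨w, hw0, hw1, rfl⟩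

theorem AffineIndependent.mem_extremePoints_convexHull {ι E : Type*} [Fintype ι] [AddCommGroup E]
    [Module ℝ E] {v : ι → E} (hv : AffineIndependent ℝ v) (i : ι) :
    v i ∈ (convexHull ℝ (Set.range v)).extremePoints ℝ := by
  classical
  refine ⟨subset_convexHull ℝ _ ⟨i, rfl⟩, fun x hx y hy hxy => ?_⟩
  obtain ⟨a, ha0, ha1, rfl⟩ := exists_weights_of_mem_convexHull_range hx
  obtain ⟨b, hb0, hb1, rfl⟩ := exists_weights_of_mem_convexHull_range hy
  obtain ⟨s, t, hs, ht, hst, h⟩ := hxy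
  have key := affineIndependent_iff.1 hv Finset.univ
    (fun j => s * a j + t * b j - (Pi.single i 1 : ι → ℝ) j)
    (by simp [Finset.sum_add_distrib, Finset.sum_sub_distrib, ← Finset.mul_sum, ha1, hb1, hst])
    (by
      have h1 : ∑ j, (Pi.single i 1 : ι → ℝ) j • v j = v i := by simp [Pi.single_apply]
      simp only [add_smul, sub_smul, mul_smul, Finset.sum_add_distrib, Finset.sum_sub_distrib,
        ← Finset.smul_sum, h1, h, sub_self])
  have ha : ∀ j ≠ i, a j = 0 := by
    intro j hj
    have h1 := key j (Finset.mem_univ j)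
    simp only [Pi.single_eq_of_ne hj, sub_zero] at h1
    have h2 := mul_nonneg hs.le (ha0 j)
    have h3 := mul_nonneg ht.le (hb0 j)
    exact (mul_eq_zero.1 (by linarith : s * a j = 0)).resolve_left hs.ne'
  have hai : a i = 1 := by rw [← ha1, Fintype.sum_eq_single i ha]
  rw [Fintype.sum_eq_single i fun j hj => by rw [ha j hj, zero_smul], hai, one_smul]

/-- Very ampleness at the vertex `v i`, in barycentric coordinates: up to a multiple of the
coordinates `l` of `u`, the coordinates `a` of a lattice point of `k • P` are integers, and
nonnegative away from `i`. -/
theorem exists_barycentric_eq {d : ℕ} {v : Fin (d + 1) → Fin d → ℝ}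
    (hlat : ∀ i, IsLatticePt (v i)) (hind : AffineIndependent ℝ v)
    (hva : IsVeryAmple (convexHull ℝ (Set.range v))) {l : Fin (d + 1) → ℝ} (hl : ∑ i, l i = 1)
    (hP : latticePts (convexHull ℝ (Set.range v)) = insert (∑ i, l i • v i) (Set.range v))
    {k : ℕ} {p : Fin d → ℝ} (hp : p ∈ convexHull ℝ (Set.range v)) {a : Fin (d + 1) → ℝ}
    (ha : ∑ i, a i = k) (hpa : (k : ℝ) • p = ∑ i, a i • v i) (hx : IsLatticePt ((k : ℝ) • p))
    (i : Fin (d + 1)) :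
    ∃ (m : ℕ) (n : Fin (d + 1) → ℤ), (∀ j, a j = m * l j + n j) ∧ ∀ j ≠ i, 0 ≤ n j := by
  obtain ⟨M, w, hw, hsum⟩ := hva (v i) (hind.mem_extremePoints_convexHull i)
    ((k : ℝ) • p - (k : ℝ) • v i) (hx.sub_natCast_smul (hlat i) k)
    ⟨k, p - v i, ⟨p, hp, rfl⟩, k.cast_nonneg, (smul_sub _ _ _).symm⟩
  rw [hP] at hw
  obtain ⟨m, n, hmn, hw⟩ := sum_eq_smul_add_sum_smul v _ w hw
  have hmn' : (m : ℝ) + ∑ j, (n j : ℝ) = M := by exact_mod_cast hmn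
  rw [Finset.sum_sub_distrib, hw, hpa] at hsum
  have key := affineIndependent_iff.1 hind Finset.univ
    (fun j => a j - m * l j - n j + (Pi.single i ((M : ℝ) - k) : Fin (d + 1) → ℝ) j)
    (by
        simp [Finset.sum_add_distrib, Finset.sum_sub_distrib, ← Finset.mul_sum, ha, hl, ← hmn']
        ring)
    (by
      have h : ∑ j, (Pi.single i ((M : ℝ) - k) : Fin (d + 1) → ℝ) j • v j
          = ((M : ℝ) - k) • v i := by simp [Pi.single_apply]
      simp only [add_smul, sub_smul, mul_smul, Finset.sum_add_distrib, Finset.sum_sub_distrib,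
        ← Finset.smul_sum, h]
      simp only [Finset.sum_const, Finset.card_univ, Fintype.card_fin,
        ← Nat.cast_smul_eq_nsmul ℝ] at hsum
      linear_combination (norm := module) hsum)
  refine ⟨m, fun j => n j - (Pi.single i ((M : ℤ) - k) : Fin (d + 1) → ℤ) j, fun j => ?_,
    fun j hj => ?_⟩
  · have := key j (Finset.mem_univ j)
    rcases eq_or_ne j i with rfl | hj
    · simp at this ⊢
      linarith
    · simp [hj] at this ⊢
      linarith
  · simp [hj]

/-- a very ample simplex with exactly one non-vertex lattice point is
normal. -/
theorem stmt7 {d : ℕ} (v : Fin (d + 1) → Fin d → ℝ)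
    (hlat : ∀ i, IsLatticePt (v i)) (hind : AffineIndependent ℝ v)
    (hva : IsVeryAmple (convexHull ℝ (Set.range v)))
    (u : Fin d → ℝ) (hu : u ∉ Set.range v)
    (hP : latticePts (convexHull ℝ (Set.range v)) = insert u (Set.range v)) :
    ∀ k : ℕ, 1 ≤ k → IsKNormal (convexHull ℝ (Set.range v)) k := by
  rintro k - x ⟨⟨p, hp, rfl⟩, hx⟩
  have hu' : u ∈ convexHull ℝ (Set.range v) :=
    (hP.symm ▸ Set.mem_insert u _ : u ∈ latticePts (convexHull ℝ (Set.range v))).1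
  have hd : d ≠ 0 := by
    rintro rfl
    exact hu ⟨0, Subsingleton.elim _ _⟩
  have : NeZero d := ⟨hd⟩
  obtain ⟨l, hl0, hl1, rfl⟩ := exists_weights_of_mem_convexHull_range hu'
  obtain ⟨b, hb0, hb1, hb⟩ := exists_weights_of_mem_convexHull_range hp
  have ha : ∑ i, k * b i = (k : ℝ) := by rw [← Finset.mul_sum, hb1, mul_one]
  have hpa : (k : ℝ) • p = ∑ i, (k * b i) • v i := by
    simp only [← hb, Finset.smul_sum, mul_smul]
  have hrep := exists_barycentric_eq hlat hind hva hl1 hP hp ha hpa hx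
  obtain ⟨i, i', m, m', n, n', hii, hmm, hn, hn0, hn', hn0'⟩ :
      ∃ (i i' : Fin (d + 1)) (m m' : ℕ) (n n' : Fin (d + 1) → ℤ), i ≠ i' ∧ m ≤ m' ∧
        (∀ j, k * b j = m * l j + n j) ∧ (∀ j ≠ i, 0 ≤ n j) ∧
        (∀ j, k * b j = m' * l j + n' j) ∧ ∀ j ≠ i', 0 ≤ n' j := by
    obtain ⟨m, n, hn, hn0⟩ := hrep 0
    obtain ⟨m', n', hn', hn0'⟩ := hrep (Fin.last d)
    have hne : (0 : Fin (d + 1)) ≠ Fin.last d := Fin.last_pos'.ne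
    rcases le_total m m' with h | h
    · exact ⟨_, _, m, m', n, n', hne, h, hn, hn0, hn', hn0'⟩
    · exact ⟨_, _, m', m, n', n, hne.symm, h, hn', hn0', hn, hn0⟩
  have hnn : ∀ j, 0 ≤ n j := by
    intro j
    rcases eq_or_ne j i with rfl | hj
    · have h1 : (0 : ℝ) ≤ n' j := by exact_mod_cast hn0' j hii
      have h2 : (m : ℝ) * l j ≤ m' * l j :=
        mul_le_mul_of_nonneg_right (by exact_mod_cast hmm) (hl0 j)
      have h3 : (0 : ℝ) ≤ n j := by linarith [hn j, hn' j]
      exact_mod_cast h3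
    · exact hn0 j hj
  lift n to Fin (d + 1) → ℕ using hnn
  simp only [Int.cast_natCast] at hn
  simp only [hn, Finset.sum_add_distrib, ← Finset.mul_sum, hl1, mul_one] at ha
  obtain ⟨w, hw, hsum⟩ := exists_sum_eq_smul_add_sum_smul v (∑ i, l i • v i) n
    (by exact_mod_cast ha : m + ∑ i, n i = k)
  refine ⟨w, fun j => hP ▸ hw j, ?_⟩
  rw [← hsum]
  simp only [hpa, hn, add_smul, mul_smul, Finset.sum_add_distrib, Finset.smul_sum]
end

section
/- Let P = conv(v_0, …, v_d) ⊂ ℝ^d be a very ample Fano d-simplex, i.e., the set of interior lattice points of P is exactly {0} and every vertex v_i is a primitive lattice vector. Then max{k_P, deg(P)} ≤ Vol(P) − |P ∩ M| + d + 1. (This is the combinatorial form of the Eisenbud–Goto bound reg(X) ≤ deg(X) − codim(X) + 1 for the projective toric variety corresponding to P.) -/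
open Set MeasureTheory
open scoped Pointwise

section LatticeOfCoordinates

variable {n : ℕ}

/-- The lattice points of `Λ` on the standard simplex. -/
def heightOne (Λ : AddSubgroup (Fin n → ℝ)) : Set (Fin n → ℝ) :=
  {x | x ∈ Λ ∧ (∀ i, 0 ≤ x i) ∧ ∑ i, x i = 1}

/-- The lattice points of `Λ` in the half-open unit cube. -/
def boxPts (Λ : AddSubgroup (Fin n → ℝ)) : Set (Fin n → ℝ) :=
  {x | x ∈ Λ ∧ ∀ i, 0 ≤ x i ∧ x i < 1}

/-- A group of vectors with integral coordinate sum that contains the standard lattice with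
finite index. -/
structure IsSimplexLattice (Λ : AddSubgroup (Fin n → ℝ)) : Prop where
  single_mem : ∀ i, Pi.single i 1 ∈ Λ
  sum_int : ∀ x ∈ Λ, ∃ z : ℤ, ∑ i, x i = z
  finite_box : (boxPts Λ).Finite

/-- The coordinatewise fractional part. -/
noncomputable def fracVec (x : Fin n → ℝ) : Fin n → ℝ := fun i => Int.fract (x i)

/-- The height of the representative of `x` in the half-open unit cube. -/
noncomputable def boxHeight (x : Fin n → ℝ) : ℕ := ⌊∑ i, Int.fract (x i)⌋₊

theorem fracVec_congr {x y : Fin n → ℝ} (h : IsLatticePt (x - y)) : fracVec x = fracVec y := by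
  funext i
  exact Int.fract_eq_fract.2 (h i)

theorem boxHeight_congr {x y : Fin n → ℝ} (h : IsLatticePt (x - y)) :
    boxHeight x = boxHeight y := by
  have : ∀ i, Int.fract (x i) = Int.fract (y i) := fun i => congrFun (fracVec_congr h) i
  simp [boxHeight, this]

theorem isLatticePt_sub_fracVec (x : Fin n → ℝ) : IsLatticePt (x - fracVec x) := fun i =>
  ⟨⌊x i⌋, by simp [fracVec]⟩

theorem fracVec_eq_self {x : Fin n → ℝ} (h : ∀ i, 0 ≤ x i ∧ x i < 1) : fracVec x = x := by
  funext i
  exact Int.fract_eq_self.2 (h i)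

/-- The group of lattice points. -/
def latticeGroup (n : ℕ) : AddSubgroup (Fin n → ℝ) where
  carrier := {x | IsLatticePt x}
  zero_mem' := fun i => ⟨0, by simp⟩
  add_mem' := fun {a b} ha hb i => by
    obtain ⟨p, hp⟩ := ha i
    obtain ⟨q, hq⟩ := hb i
    exact ⟨p + q, by simp [hp, hq]⟩
  neg_mem' := fun {a} ha i => by
    obtain ⟨p, hp⟩ := ha i
    exact ⟨-p, by simp [hp]⟩

theorem mem_latticeGroup {x : Fin n → ℝ} : x ∈ latticeGroup n ↔ IsLatticePt x := Iff.rfl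

namespace IsSimplexLattice

variable {Λ : AddSubgroup (Fin n → ℝ)}

theorem mem_of_isLatticePt (hΛ : IsSimplexLattice Λ) {x : Fin n → ℝ} (hx : IsLatticePt x) :
    x ∈ Λ := by
  choose z hz using hx
  have : x = ∑ i, z i • (Pi.single i 1 : Fin n → ℝ) := by
    funext j
    simp [Finset.sum_apply, Pi.single_apply, hz]
  rw [this]
  exact sum_mem fun i _ => zsmul_mem (hΛ.single_mem i) _

theorem fracVec_mem (hΛ : IsSimplexLattice Λ) {x : Fin n → ℝ} (hx : x ∈ Λ) : fracVec x ∈ Λ := by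
  have := sub_mem hx (hΛ.mem_of_isLatticePt (isLatticePt_sub_fracVec x))
  simpa using this

theorem fracVec_mem_boxPts (hΛ : IsSimplexLattice Λ) {x : Fin n → ℝ} (hx : x ∈ Λ) :
    fracVec x ∈ boxPts Λ :=
  ⟨hΛ.fracVec_mem hx, fun _ => ⟨Int.fract_nonneg _, Int.fract_lt_one _⟩⟩

theorem exists_nat_sum (hΛ : IsSimplexLattice Λ) {x : Fin n → ℝ} (hx : x ∈ Λ)
    (h0 : ∀ i, 0 ≤ x i) : ∃ k : ℕ, ∑ i, x i = k := by
  obtain ⟨z, hz⟩ := hΛ.sum_int x hx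
  have : (0 : ℝ) ≤ z := hz ▸ Finset.sum_nonneg fun i _ => h0 i
  lift z to ℕ using by exact_mod_cast this
  exact ⟨z, by simpa using hz⟩

theorem boxHeight_cast (hΛ : IsSimplexLattice Λ) {x : Fin n → ℝ} (hx : x ∈ Λ) :
    (boxHeight x : ℝ) = ∑ i, Int.fract (x i) := by
  obtain ⟨k, hk⟩ := hΛ.exists_nat_sum (hΛ.fracVec_mem hx) fun i => Int.fract_nonneg _
  have hk' : ∑ i, Int.fract (x i) = k := hk
  simp [boxHeight, hk']

theorem boxHeight_add_le (hΛ : IsSimplexLattice Λ) {x y : Fin n → ℝ} (hx : x ∈ Λ) (hy : y ∈ Λ) :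
    boxHeight (x + y) ≤ boxHeight x + boxHeight y := by
  have : (boxHeight (x + y) : ℝ) ≤ boxHeight x + boxHeight y := by
    rw [hΛ.boxHeight_cast hx, hΛ.boxHeight_cast hy, hΛ.boxHeight_cast (add_mem hx hy),
      ← Finset.sum_add_distrib]
    exact Finset.sum_le_sum fun i _ => Int.fract_add_le _ _
  exact_mod_cast this

theorem boxHeight_fracVec (x : Fin n → ℝ) : boxHeight (fracVec x) = boxHeight x := by
  simp [boxHeight, fracVec]

theorem boxHeight_of_box (hΛ : IsSimplexLattice Λ) {x : Fin n → ℝ} (hx : x ∈ Λ)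
    (h : ∀ i, 0 ≤ x i ∧ x i < 1) : (boxHeight x : ℝ) = ∑ i, x i := by
  rw [hΛ.boxHeight_cast hx]
  exact Finset.sum_congr rfl fun i _ => Int.fract_eq_self.2 (h i)

theorem boxHeight_le_one (hΛ : IsSimplexLattice Λ) {u : Fin n → ℝ} (hu : u ∈ heightOne Λ) :
    boxHeight u ≤ 1 := by
  have : (boxHeight u : ℝ) ≤ 1 := by
    rw [hΛ.boxHeight_cast hu.1, ← hu.2.2]
    refine Finset.sum_le_sum fun i _ => ?_
    have : (0 : ℝ) ≤ ⌊u i⌋ := by exact_mod_cast Int.floor_nonneg.2 (hu.2.1 i)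
    have := Int.self_sub_floor (u i)
    linarith
  exact_mod_cast this

theorem single_mem_heightOne (hΛ : IsSimplexLattice Λ) (i : Fin n) :
    Pi.single i 1 ∈ heightOne Λ := by
  refine ⟨hΛ.single_mem i, fun j => ?_, by simp⟩
  by_cases h : j = i
  · subst h; simp
  · simp [h]

/-- Subtracting a lattice point of the simplex from a point it does not divide does not lower the
height. -/
theorem boxHeight_le_boxHeight_sub (hΛ : IsSimplexLattice Λ) {y u : Fin n → ℝ} (hy : y ∈ Λ)
    (hy1 : ∀ i, 0 ≤ y i ∧ y i < 1) (hu : u ∈ heightOne Λ) (hyu : ¬ ∀ i, 0 ≤ (y - u) i) :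
    boxHeight y ≤ boxHeight (y - u) := by
  by_contra! hlt
  apply hyu
  have hc : (boxHeight (y - u) : ℝ) + 1 ≤ boxHeight y := by exact_mod_cast hlt
  rw [hΛ.boxHeight_cast (sub_mem hy hu.1), hΛ.boxHeight_of_box hy hy1, ← hu.2.2] at hc
  have hle : ∀ i, (y - u) i ≤ Int.fract ((y - u) i) := by
    intro i
    have h1 : (y - u) i < 1 := by
      have := hu.2.1 i
      have := (hy1 i).2
      simp only [Pi.sub_apply]
      linarith
    have h2 : ⌊(y - u) i⌋ ≤ 0 := Int.lt_add_one_iff.1 (Int.floor_lt.2 (by simpa using h1))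
    have h3 : (⌊(y - u) i⌋ : ℝ) ≤ 0 := by exact_mod_cast h2
    have := Int.self_sub_floor ((y - u) i)
    linarith
  have hsum : ∑ i, (Int.fract ((y - u) i) - (y - u) i) ≤ 0 := by
    simp only [Pi.sub_apply, Finset.sum_sub_distrib] at hc ⊢
    linarith
  have hz := (Finset.sum_eq_zero_iff_of_nonneg fun i _ => sub_nonneg.2 (hle i)).1
    (le_antisymm hsum (Finset.sum_nonneg fun i _ => sub_nonneg.2 (hle i)))
  intro i
  have := hz i (Finset.mem_univ i)
  have h0 := Int.fract_nonneg ((y - u) i)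
  linarith

end IsSimplexLattice
end LatticeOfCoordinates

section Decomposition

variable {n : ℕ}

/-- The semigroup generated by the lattice points of the standard simplex. -/
def simplexSemigroup (Λ : AddSubgroup (Fin n → ℝ)) : AddSubmonoid (Fin n → ℝ) :=
  AddSubmonoid.closure (heightOne Λ)

/-- Very ampleness: adding enough copies of any vertex brings a nonnegative lattice point into the
semigroup generated in height one. -/
def VeryAmpleLattice (Λ : AddSubgroup (Fin n → ℝ)) : Prop :=
  ∀ i, ∀ x ∈ Λ, (∀ k, 0 ≤ x k) → ∃ m : ℕ, x + m • Pi.single i (1 : ℝ) ∈ simplexSemigroup Λ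

/-- A point of the cone from which no lattice point of the simplex can be subtracted. -/
def Indecomposable (Λ : AddSubgroup (Fin n → ℝ)) (y : Fin n → ℝ) : Prop :=
  ∀ u ∈ heightOne Λ, ¬ ∀ i, 0 ≤ (y - u) i

variable {Λ : AddSubgroup (Fin n → ℝ)}

theorem heightOne_subset_simplexSemigroup {u : Fin n → ℝ} (hu : u ∈ heightOne Λ) :
    u ∈ simplexSemigroup Λ := AddSubmonoid.subset_closure hu

theorem exists_multiset_of_mem_simplexSemigroup {x : Fin n → ℝ} (hx : x ∈ simplexSemigroup Λ) :
    ∃ s : Multiset (Fin n → ℝ), (∀ u ∈ s, u ∈ heightOne Λ) ∧ s.sum = x :=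
  AddSubmonoid.exists_multiset_of_mem_closure hx

theorem multiset_sum_mem_simplexSemigroup {s : Multiset (Fin n → ℝ)}
    (hs : ∀ u ∈ s, u ∈ heightOne Λ) : s.sum ∈ simplexSemigroup Λ :=
  multiset_sum_mem _ fun u hu => heightOne_subset_simplexSemigroup (hs u hu)

theorem mem_and_nonneg_of_mem_simplexSemigroup {x : Fin n → ℝ} (hx : x ∈ simplexSemigroup Λ) :
    x ∈ Λ ∧ ∀ i, 0 ≤ x i := by
  induction hx using AddSubmonoid.closure_induction with
  | mem u hu => exact ⟨hu.1, hu.2.1⟩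
  | zero => exact ⟨zero_mem _, fun i => le_rfl⟩
  | add x y _ _ hx hy => exact ⟨add_mem hx.1 hy.1, fun i => add_nonneg (hx.2 i) (hy.2 i)⟩

namespace IsSimplexLattice

theorem natVec_mem_simplexSemigroup (hΛ : IsSimplexLattice Λ) (a : Fin n → ℕ) :
    (fun i => (a i : ℝ)) ∈ simplexSemigroup Λ := by
  have : (fun i => (a i : ℝ)) = ∑ i, a i • (Pi.single i 1 : Fin n → ℝ) := by
    funext j
    simp [Finset.sum_apply, Pi.single_apply]
  rw [this]
  exact sum_mem fun i _ =>
    nsmul_mem (heightOne_subset_simplexSemigroup (hΛ.single_mem_heightOne i)) _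

/-- A bad point of the box becomes divisible by a sum of two lattice points of the simplex as soon
as one vertex is added. -/
theorem exists_pair (hΛ : IsSimplexLattice Λ) (hva : VeryAmpleLattice Λ) {y : Fin n → ℝ}
    (hy : y ∈ Λ) (hy1 : ∀ i, 0 ≤ y i ∧ y i < 1) (hyS : y ∉ simplexSemigroup Λ) (i : Fin n) :
    ∃ u ∈ heightOne Λ, ∃ u' ∈ heightOne Λ, ∀ k, 0 ≤ (y + Pi.single i (1 : ℝ) - u - u' : Fin n → ℝ) k := by
  classical
  have hex := hva i y hy fun k => (hy1 k).1
  obtain ⟨m, hm⟩ : ∃ m, m = Nat.find hex := ⟨_, rfl⟩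
  have hspec : y + m • Pi.single i (1 : ℝ) ∈ simplexSemigroup Λ := hm ▸ Nat.find_spec hex
  have hmin : ∀ j < m, y + j • Pi.single i (1 : ℝ) ∉ simplexSemigroup Λ := fun j hj =>
    Nat.find_min hex (hm ▸ hj)
  obtain _ | m := m
  · exact absurd (by simpa using hspec) hyS
  obtain ⟨s, hs, hsum⟩ := exists_multiset_of_mem_simplexSemigroup hspec
  have hnn : ∀ t : Multiset (Fin n → ℝ), (∀ u ∈ t, u ∈ heightOne Λ) → ∀ k, 0 ≤ t.sum k :=
    fun t ht => (mem_and_nonneg_of_mem_simplexSemigroup (multiset_sum_mem_simplexSemigroup ht)).2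
  have hexp : ∀ k, s.sum k = y k + (m + 1 : ℝ) * Pi.single (M := fun _ => ℝ) i 1 k := by
    intro k
    rw [hsum]
    simp
  obtain ⟨N, hN⟩ := hΛ.exists_nat_sum hy fun k => (hy1 k).1
  have hN1 : 1 ≤ N := by
    by_contra! h
    have h0 : ∑ k, y k = 0 := by rw [hN]; simp [Nat.lt_one_iff.1 h]
    have hz := (Finset.sum_eq_zero_iff_of_nonneg fun k _ => (hy1 k).1).1 h0
    apply hyS
    rw [show y = 0 from funext fun k => hz k (Finset.mem_univ k)]
    exact zero_mem _
  have htot : ∑ k, s.sum k = N + (m + 1) := by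
    simp only [hexp, Finset.sum_add_distrib, ← Finset.mul_sum, hN]
    simp
  have hN1' : (1 : ℝ) ≤ N := by exact_mod_cast hN1
  have hm0 : (0 : ℝ) ≤ m := Nat.cast_nonneg m
  induction s using Multiset.induction_on with
  | empty => simp at htot; linarith
  | cons u s _ =>
    induction s using Multiset.induction_on with
    | empty =>
      have := (hs u (by simp)).2.2
      simp only [Multiset.sum_cons, Multiset.sum_zero, add_zero] at htot
      linarith
    | cons u' t _ =>
      have hu := hs u (by simp)
      have hu' := hs u' (by simp)
      have ht : ∀ w ∈ t, w ∈ heightOne Λ := fun w hw => hs w (by simp [hw])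
      simp only [Multiset.sum_cons] at hexp hsum
      refine ⟨u, hu, u', hu', fun k => ?_⟩
      have htk := hnn t ht k
      have hek := hexp k
      simp only [Pi.add_apply] at hek
      simp only [Pi.add_apply, Pi.sub_apply]
      by_cases hk : k = i
      · subst hk
        simp only [Pi.single_eq_same] at hek ⊢
        by_contra! hneg
        have hyk := (hy1 k).1
        have hu2 : u + u' - Pi.single k 1 ∈ heightOne Λ := by
          refine ⟨sub_mem (add_mem hu.1 hu'.1) (hΛ.single_mem k), fun l => ?_, ?_⟩
          · by_cases hl : l = k
            · subst hl
              simp only [Pi.add_apply, Pi.sub_apply, Pi.single_eq_same]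
              linarith
            · have := hu.2.1 l
              have := hu'.2.1 l
              simp only [Pi.add_apply, Pi.sub_apply, Pi.single_eq_of_ne hl]
              linarith
          · simp only [Pi.add_apply, Pi.sub_apply, Finset.sum_add_distrib,
              Finset.sum_sub_distrib, hu.2.2, hu'.2.2]
            simp
        apply hmin m (Nat.lt_succ_self m)
        have : y + m • Pi.single k (1 : ℝ) = (u + u' - Pi.single k 1) + t.sum := by
          rw [succ_nsmul] at hsum
          have : u + u' - Pi.single k 1 + t.sum = (u + (u' + t.sum)) - Pi.single k 1 := by abel
          rw [this, hsum]
          abel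
        rw [this]
        exact add_mem (heightOne_subset_simplexSemigroup hu2)
          (multiset_sum_mem_simplexSemigroup ht)
      · simp only [Pi.single_eq_of_ne hk, mul_zero] at hek ⊢
        linarith

/-- A cone point of height `h` lies in the semigroup after adding any `h - 1` vertices. -/
theorem add_natVec_mem (hΛ : IsSimplexLattice Λ) (hva : VeryAmpleLattice Λ) (h : ℕ) :
    ∀ y ∈ Λ, (∀ i, 0 ≤ y i) → ∑ i, y i = h → ∀ a : Fin n → ℕ, h ≤ ∑ i, a i + 1 →
      y + (fun i => (a i : ℝ)) ∈ simplexSemigroup Λ := by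
  induction h with
  | zero =>
    intro y hy h0 hsum a _
    have hz := (Finset.sum_eq_zero_iff_of_nonneg fun k _ => h0 k).1 (by simpa using hsum)
    rw [show y = 0 from funext fun k => hz k (Finset.mem_univ k), zero_add]
    exact hΛ.natVec_mem_simplexSemigroup a
  | succ h ih =>
    intro y hy h0 hsum a ha
    push_cast at hsum
    by_cases hyS : y ∈ simplexSemigroup Λ
    · exact add_mem hyS (hΛ.natVec_mem_simplexSemigroup a)
    by_cases hbig : ∃ k, 1 ≤ y k
    · obtain ⟨k, hk⟩ := hbig
      have h1 := ih (y - Pi.single k 1) (sub_mem hy (hΛ.single_mem k)) (fun i => by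
        by_cases hi : i = k
        · subst hi; simpa using hk
        · simpa [hi] using h0 i) (by
        simp only [Pi.sub_apply, Finset.sum_sub_distrib, hsum]; simp) a (by omega)
      have h2 := add_mem h1 (heightOne_subset_simplexSemigroup (hΛ.single_mem_heightOne k))
      convert h2 using 1
      abel
    · push Not at hbig
      have ha0 : 0 < ∑ i, a i := by
        by_contra! hle
        have hh : h = 0 := by omega
        exact hyS (heightOne_subset_simplexSemigroup ⟨hy, h0, by simpa [hh] using hsum⟩)
      obtain ⟨i, -, hi⟩ := Finset.sum_pos_iff.1 ha0
      obtain ⟨u, hu, u', hu', hnn⟩ := hΛ.exists_pair hva hy (fun k => ⟨h0 k, hbig k⟩) hyS i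
      have hsplit : (fun k => (a k : ℝ)) =
          Pi.single i 1 + fun k => ((Function.update a i (a i - 1) k : ℕ) : ℝ) := by
        funext k
        by_cases hk : k = i
        · subst hk
          simp [Nat.cast_sub (Nat.succ_le_of_lt hi)]
        · simp [hk]
      have hupd : ∑ k, Function.update a i (a i - 1) k + 1 = ∑ k, a k := by
        rw [Finset.sum_update_of_mem (Finset.mem_univ i),
          ← Finset.add_sum_erase _ _ (Finset.mem_univ i), Finset.sdiff_singleton_eq_erase]
        omega
      have h1 := ih (y + Pi.single i 1 - u - u')
        (sub_mem (sub_mem (add_mem hy (hΛ.single_mem i)) hu.1) hu'.1) hnn (by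
          simp only [Pi.add_apply, Pi.sub_apply, Finset.sum_add_distrib, Finset.sum_sub_distrib,
            hsum, hu.2.2, hu'.2.2]
          simp) (Function.update a i (a i - 1)) (by omega)
      have h2 := add_mem (add_mem h1 (heightOne_subset_simplexSemigroup hu))
        (heightOne_subset_simplexSemigroup hu')
      rw [hsplit]
      convert h2 using 1
      abel

end IsSimplexLattice

/-- A cone point outside the semigroup is an indecomposable such point plus an element of the
semigroup. -/
theorem exists_indecomposable (h : ℕ) :
    ∀ b ∈ Λ, (∀ i, 0 ≤ b i) → ∑ i, b i = h → b ∉ simplexSemigroup Λ →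
      ∃ y ∈ Λ, (∀ i, 0 ≤ y i) ∧ y ∉ simplexSemigroup Λ ∧ Indecomposable Λ y ∧
        b - y ∈ simplexSemigroup Λ := by
  induction h with
  | zero =>
    intro b _ h0 hsum hbS
    have hz := (Finset.sum_eq_zero_iff_of_nonneg fun k _ => h0 k).1 (by simpa using hsum)
    rw [show b = 0 from funext fun k => hz k (Finset.mem_univ k)] at hbS
    exact absurd (zero_mem _) hbS
  | succ h ih =>
    intro b hb h0 hsum hbS
    by_cases hind : Indecomposable Λ b
    · exact ⟨b, hb, h0, hbS, hind, by simp⟩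
    · unfold Indecomposable at hind
      push Not at hind
      obtain ⟨u, hu, hnn⟩ := hind
      have huS := heightOne_subset_simplexSemigroup hu
      obtain ⟨y, hy, hy0, hyS, hyi, hyb⟩ := ih (b - u) (sub_mem hb hu.1) hnn (by
        simp only [Pi.sub_apply, Finset.sum_sub_distrib, hsum, hu.2.2]; simp) (fun hc => hbS (by
          simpa using add_mem hc huS))
      refine ⟨y, hy, hy0, hyS, hyi, ?_⟩
      have := add_mem hyb huS
      convert this using 1
      abel

end Decomposition

section Counting

theorem exists_eq_of_succ_le_add_one {f : ℕ → ℕ} (hf : ∀ m, f (m + 1) ≤ f m + 1) {a b k : ℕ}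
    (hab : a ≤ b) (ha : f a ≤ k) (hb : k ≤ f b) : ∃ m, a ≤ m ∧ m ≤ b ∧ f m = k := by
  induction b, hab using Nat.le_induction with
  | base => exact ⟨a, le_rfl, le_rfl, le_antisymm ha hb⟩
  | succ b hab ih =>
    by_cases h : k ≤ f b
    · obtain ⟨m, h1, h2, h3⟩ := ih h
      exact ⟨m, h1, h2.trans (Nat.le_succ b), h3⟩
    · have := hf b
      exact ⟨b + 1, by omega, le_rfl, by omega⟩

theorem le_card_of_fibers {α : Type*} (s : Finset α) (f : α → ℕ) {h d : ℕ} (hd : h ≤ d)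
    (h1 : ∀ k, 2 ≤ k → k ≤ d → ∃ x ∈ s, f x = k)
    (h2 : ∀ k, 2 ≤ k → k ≤ h → ∃ x ∈ s, ∃ x' ∈ s, x ≠ x' ∧ f x = k ∧ f x' = k) :
    (d - 1) + (h - 1) ≤ s.card := by
  classical
  calc (d - 1) + (h - 1) = ∑ k ∈ Finset.Icc 2 d, (1 + if k ≤ h then 1 else 0) := by
        rw [Finset.sum_add_distrib, ← Finset.card_filter]
        have : (Finset.Icc 2 d).filter (fun k => k ≤ h) = Finset.Icc 2 h := by
          ext k
          simp only [Finset.mem_filter, Finset.mem_Icc]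
          omega
        rw [this]
        simp
    _ ≤ ∑ k ∈ Finset.Icc 2 d, (s.filter fun x => f x = k).card := by
        refine Finset.sum_le_sum fun k hk => ?_
        obtain ⟨hk2, hkd⟩ := Finset.mem_Icc.1 hk
        split_ifs with hkh
        · obtain ⟨x, hx, x', hx', hne, hfx, hfx'⟩ := h2 k hk2 hkh
          exact Finset.one_lt_card.2 ⟨x, by simp [hx, hfx], x', by simp [hx', hfx'], hne⟩
        · obtain ⟨x, hx, hfx⟩ := h1 k hk2 hkd
          exact Finset.card_pos.2 ⟨x, by simp [hx, hfx]⟩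
    _ = (s.filter fun x => f x ∈ Finset.Icc 2 d).card := by
        rw [Finset.card_eq_sum_card_fiberwise (f := f)
          (s := s.filter fun x => f x ∈ Finset.Icc 2 d) (t := Finset.Icc 2 d)
          (fun x hx => Finset.mem_coe.2 (Finset.mem_filter.1 (Finset.mem_coe.1 hx)).2)]
        refine Finset.sum_congr rfl fun k hk => ?_
        congr 1
        ext x
        simp only [Finset.mem_filter]
        constructor
        · rintro ⟨hx, rfl⟩; exact ⟨⟨hx, hk⟩, rfl⟩
        · rintro ⟨⟨hx, -⟩, rfl⟩; exact ⟨hx, rfl⟩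
    _ ≤ s.card := Finset.card_filter_le _ _

variable {n : ℕ} {Λ : AddSubgroup (Fin n → ℝ)} {g : Fin n → ℝ}

theorem exists_pos_nsmul_isLatticePt (hΛ : IsSimplexLattice Λ) (hg : g ∈ Λ) :
    ∃ q : ℕ, 0 < q ∧ IsLatticePt (q • g) := by
  obtain ⟨a, b, hab, h⟩ := Set.Finite.exists_lt_map_eq_of_forall_mem
    (f := fun m : ℕ => fracVec (m • g)) (fun m => hΛ.fracVec_mem_boxPts (nsmul_mem hg m))
    hΛ.finite_box
  refine ⟨b - a, by omega, ?_⟩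
  have h1 := isLatticePt_sub_fracVec (b • g)
  have h2 := isLatticePt_sub_fracVec (a • g)
  have h3 := (latticeGroup n).sub_mem h1 h2
  rw [mem_latticeGroup] at h3
  convert h3 using 1
  rw [h, sub_nsmul _ hab.le]
  abel

namespace IsSimplexLattice

theorem boxHeight_lt (hΛ : IsSimplexLattice Λ) (hn : 0 < n) {x : Fin n → ℝ} (hx : x ∈ Λ) :
    boxHeight x < n := by
  have : (boxHeight x : ℝ) < n := by
    rw [hΛ.boxHeight_cast hx]
    have : NeZero n := ⟨hn.ne'⟩
    calc ∑ i, Int.fract (x i) < ∑ _i : Fin n, (1 : ℝ) :=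
          Finset.sum_lt_sum_of_nonempty Finset.univ_nonempty fun i _ => Int.fract_lt_one _
      _ = n := by simp
  exact_mod_cast this

theorem boxHeight_nsmul_add_step (hΛ : IsSimplexLattice Λ) (hg : g ∈ heightOne Λ)
    {c : Fin n → ℝ} (hc : c ∈ Λ) (m : ℕ) :
    boxHeight ((m + 1) • g + c) ≤ boxHeight (m • g + c) + 1 := by
  have h1 := hΛ.boxHeight_add_le (add_mem (nsmul_mem hg.1 m) hc) hg.1
  have h2 := hΛ.boxHeight_le_one hg
  rw [show (m + 1) • g + c = m • g + c + g by rw [succ_nsmul]; abel]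
  omega

end IsSimplexLattice

theorem isLatticePt_of_box {x : Fin n → ℝ} (h : ∀ i, 0 ≤ x i ∧ x i < 1) (hx : IsLatticePt x) :
    x = 0 := by
  funext i
  obtain ⟨z, hz⟩ := hx i
  have := Int.fract_eq_self.2 (h i)
  rw [hz, Int.fract_intCast] at this
  rw [hz, ← this]
  rfl

theorem lt_one_of_sum_eq_one (hn : 2 ≤ n) (hpos : ∀ i, 0 < g i) (hsum : ∑ i, g i = 1) (i : Fin n) :
    g i < 1 := by
  have : Nontrivial (Fin n) := Fin.nontrivial_iff_two_le.2 hn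
  obtain ⟨j, hj⟩ := exists_ne i
  rw [← hsum]
  exact Finset.single_lt_sum hj (Finset.mem_univ i) (Finset.mem_univ j) (hpos j)
    fun k _ _ => (hpos k).le

theorem boxHeight_neg_interior (hn : 2 ≤ n) (hpos : ∀ i, 0 < g i)
    (hsum : ∑ i, g i = 1) : boxHeight (-g) = n - 1 := by
  have h : ∀ i, Int.fract ((-g) i) = 1 - g i := fun i => by
    have h1 : Int.fract (g i) = g i :=
      Int.fract_eq_self.2 ⟨(hpos i).le, lt_one_of_sum_eq_one hn hpos hsum i⟩
    rw [Pi.neg_apply, Int.fract_neg (by rw [h1]; exact (hpos i).ne'), h1]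
  have : ∑ i, Int.fract ((-g) i) = ((n - 1 : ℕ) : ℝ) := by
    rw [Nat.cast_sub (by omega)]
    simp only [h, Finset.sum_sub_distrib, hsum]
    simp
  rw [boxHeight, this, Nat.floor_natCast]

/-- The subgroup generated by `g` and the integral vectors. -/
def cyclicPart (g : Fin n → ℝ) : AddSubgroup (Fin n → ℝ) :=
  AddSubgroup.zmultiples g ⊔ latticeGroup n

theorem isLatticePt_mem_cyclicPart {x : Fin n → ℝ} (hx : IsLatticePt x) : x ∈ cyclicPart g :=
  AddSubgroup.mem_sup_right hx

theorem nsmul_mem_cyclicPart (m : ℕ) : m • g ∈ cyclicPart g :=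
  nsmul_mem (AddSubgroup.mem_sup_left (AddSubgroup.mem_zmultiples g)) m

theorem mem_cyclicPart_congr {x y : Fin n → ℝ} (h : IsLatticePt (x - y)) :
    x ∈ cyclicPart g ↔ y ∈ cyclicPart g := by
  have := isLatticePt_mem_cyclicPart (g := g) h
  constructor
  · intro hx; simpa using sub_mem hx this
  · intro hy; simpa using add_mem this hy

theorem exists_nat_of_mem_cyclicPart {q : ℕ} (hq : 0 < q) (hqg : IsLatticePt (q • g))
    {x : Fin n → ℝ} (hx : x ∈ cyclicPart g) : ∃ m < q, IsLatticePt (x - m • g) := by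
  obtain ⟨y, hy, w, hw, rfl⟩ := AddSubgroup.mem_sup.1 hx
  obtain ⟨m, rfl⟩ := AddSubgroup.mem_zmultiples_iff.1 hy
  have hq' : (0 : ℤ) < q := by exact_mod_cast hq
  have h0 := Int.emod_nonneg m hq'.ne'
  have h1 := Int.emod_lt_of_pos m hq'
  obtain ⟨r, hr⟩ := Int.eq_ofNat_of_zero_le h0
  refine ⟨r, by omega, ?_⟩
  have h2 := (latticeGroup n).add_mem ((latticeGroup n).zsmul_mem hqg (m / q)) hw
  rw [mem_latticeGroup] at h2
  convert h2 using 1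
  have h3 : m = q * (m / q) + r := by rw [← hr, Int.mul_ediv_add_emod]
  have h4 : m • g = (m / q) • (q • g) + r • g := by
    conv_lhs => rw [h3]
    rw [add_zsmul, mul_comm, mul_zsmul, natCast_zsmul, natCast_zsmul]
  rw [h4]
  abel

/-- Multiples of an interior point attain every height. -/
theorem exists_nsmul_boxHeight (hΛ : IsSimplexLattice Λ) (hn : 2 ≤ n) (hg : g ∈ heightOne Λ)
    (hpos : ∀ i, 0 < g i) {k : ℕ} (hk : k ≤ n - 1) :
    ∃ m : ℕ, boxHeight (m • g) = k := by
  obtain ⟨q, hq, hqg⟩ := exists_pos_nsmul_isLatticePt hΛ hg.1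
  have hend : boxHeight ((q - 1) • g) = n - 1 := by
    rw [← boxHeight_neg_interior hn hpos hg.2.2]
    apply boxHeight_congr
    rw [sub_neg_eq_add, ← succ_nsmul, Nat.sub_add_cancel hq]
    exact hqg
  obtain ⟨m, -, -, hm⟩ := exists_eq_of_succ_le_add_one (f := fun m => boxHeight (m • g))
    (fun m => by simpa using hΛ.boxHeight_nsmul_add_step hg (zero_mem Λ) m) (Nat.zero_le (q - 1))
    (k := k) (by simp [boxHeight]) (by simpa only [hend] using hk)
  exact ⟨m, hm⟩

/-- Outside the cyclic part, all heights up to that of a given element are attained. -/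
theorem exists_not_mem_cyclicPart (hΛ : IsSimplexLattice Λ) (hva : VeryAmpleLattice Λ)
    (hg : g ∈ heightOne Λ) {c : Fin n → ℝ} (hc : c ∈ Λ) (hcg : c ∉ cyclicPart g) {k : ℕ}
    (hk1 : 1 ≤ k) (hk : k ≤ boxHeight c) :
    ∃ x ∈ Λ, x ∉ cyclicPart g ∧ boxHeight x = k := by
  have key : ∀ s : Multiset (Fin n → ℝ), (∀ u ∈ s, u ∈ heightOne Λ) → s.sum ∉ cyclicPart g →
      k ≤ boxHeight s.sum → ∃ x ∈ Λ, x ∉ cyclicPart g ∧ boxHeight x = k := by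
    intro s
    induction s using Multiset.induction_on with
    | empty => intro _ h _; exact absurd (zero_mem _) h
    | cons u t ih =>
      intro hs hsum hle
      have hu := hs u (by simp)
      have ht : ∀ w ∈ t, w ∈ heightOne Λ := fun w hw => hs w (by simp [hw])
      have htΛ : t.sum ∈ Λ :=
        (mem_and_nonneg_of_mem_simplexSemigroup (multiset_sum_mem_simplexSemigroup ht)).1
      rw [Multiset.sum_cons] at hsum hle
      by_cases htg : t.sum ∈ cyclicPart g
      · have hug : u ∉ cyclicPart g := fun h => hsum (add_mem h htg)
        obtain ⟨q, hq, hqg⟩ := exists_pos_nsmul_isLatticePt hΛ hg.1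
        obtain ⟨m, -, hm⟩ := exists_nat_of_mem_cyclicPart hq hqg htg
        have hend : boxHeight (m • g + u) = boxHeight (u + t.sum) := by
          apply boxHeight_congr
          have := (latticeGroup n).neg_mem hm
          rw [mem_latticeGroup] at this
          convert this using 1
          abel
        obtain ⟨j, -, -, hj⟩ := exists_eq_of_succ_le_add_one
          (f := fun m => boxHeight (m • g + u))
          (fun m => hΛ.boxHeight_nsmul_add_step hg hu.1 m) (Nat.zero_le m) (k := k)
          (by simpa using (hΛ.boxHeight_le_one hu).trans hk1) (by simpa only [hend] using hle)
        refine ⟨j • g + u, add_mem (nsmul_mem hg.1 j) hu.1, fun h => hug ?_, hj⟩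
        simpa using sub_mem h (nsmul_mem_cyclicPart j)
      · by_cases hkt : k ≤ boxHeight t.sum
        · exact ih ht htg hkt
        · have h1 := hΛ.boxHeight_add_le hu.1 htΛ
          have h2 := hΛ.boxHeight_le_one hu
          exact ⟨u + t.sum, add_mem hu.1 htΛ, hsum, by omega⟩
  have hn : 0 < n := by
    rcases Nat.eq_zero_or_pos n with rfl | h
    · exact absurd (isLatticePt_mem_cyclicPart fun i => i.elim0) hcg
    · exact h
  obtain ⟨m, hm⟩ := hva ⟨0, hn⟩ (fracVec c) (hΛ.fracVec_mem hc) fun i => Int.fract_nonneg _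
  obtain ⟨s, hs, hsum⟩ := exists_multiset_of_mem_simplexSemigroup hm
  have hinteg : IsLatticePt (c - s.sum) := by
    have h1 := (latticeGroup n).sub_mem (isLatticePt_sub_fracVec c)
      ((latticeGroup n).nsmul_mem (x := Pi.single ⟨0, hn⟩ (1 : ℝ)) (fun i =>
        ⟨Pi.single (M := fun _ => ℤ) ⟨0, hn⟩ 1 i, by
          by_cases hi : i = ⟨0, hn⟩
          · subst hi; simp
          · simp [hi]⟩) m)
    rw [mem_latticeGroup] at h1
    rw [hsum]
    convert h1 using 1
    abel
  exact key s hs (fun h => hcg ((mem_cyclicPart_congr hinteg).2 h)) (boxHeight_congr hinteg ▸ hk)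

/-- An indecomposable bad point forces a lattice point of the simplex other than the vertices and
`g`. -/
theorem exists_heightOne_ne (hva : VeryAmpleLattice Λ) (hn : 3 ≤ n)
    (hpos : ∀ i, 0 < g i) (hg : g ∈ heightOne Λ) {y : Fin n → ℝ} (hy : y ∈ Λ)
    (hy1 : ∀ i, 0 ≤ y i ∧ y i < 1) (hyS : y ∉ simplexSemigroup Λ) :
    ∃ u ∈ heightOne Λ, u ≠ g ∧ ∀ i, u i < 1 := by
  by_contra! hcon
  have hform : ∀ x ∈ simplexSemigroup Λ, ∃ N : ℕ, ∃ a : Fin n → ℕ,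
      ∀ i, x i = N * g i + a i := by
    intro x hx
    induction hx using AddSubmonoid.closure_induction with
    | mem u hu =>
      by_cases hug : u = g
      · exact ⟨1, 0, fun i => by simp [hug]⟩
      · obtain ⟨k, hk⟩ := hcon u hu hug
        have hsplit := Finset.add_sum_erase Finset.univ u (Finset.mem_univ k)
        rw [hu.2.2] at hsplit
        have hnn : 0 ≤ ∑ i ∈ Finset.univ.erase k, u i := Finset.sum_nonneg fun i _ => hu.2.1 i
        have hz := (Finset.sum_eq_zero_iff_of_nonneg (s := Finset.univ.erase k)
          fun i _ => hu.2.1 i).1 (by linarith)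
        refine ⟨0, Pi.single k 1, fun i => ?_⟩
        by_cases hi : i = k
        · subst hi
          simp only [Pi.single_eq_same, Nat.cast_zero, zero_mul, zero_add, Nat.cast_one]
          linarith
        · simp [hi, hz i (by simp [hi])]
    | zero => exact ⟨0, 0, fun i => by simp⟩
    | add x x' _ _ hx hx' =>
      obtain ⟨N, a, h⟩ := hx
      obtain ⟨N', a', h'⟩ := hx'
      exact ⟨N + N', a + a', fun i => by simp [h, h']; ring⟩
  have hmult : ∀ i, ∃ N : ℕ, ∀ k, k ≠ i → y k = N * g k := by
    intro i
    obtain ⟨m, hm⟩ := hva i y hy fun k => (hy1 k).1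
    obtain ⟨N, a, h⟩ := hform _ hm
    refine ⟨N, fun k hk => ?_⟩
    have hk' := h k
    simp only [Pi.add_apply, Pi.smul_apply, Pi.single_eq_of_ne hk, smul_zero, add_zero] at hk'
    have h1 : (a k : ℝ) < 1 := by
      have := (hy1 k).2
      have : 0 ≤ (N : ℝ) * g k := mul_nonneg (Nat.cast_nonneg N) (hpos k).le
      linarith
    have h2 : a k = 0 := by
      have : a k < 1 := by exact_mod_cast h1
      omega
    simpa [h2] using hk'
  obtain ⟨N, hN⟩ := hmult ⟨0, by omega⟩
  obtain ⟨N', hN'⟩ := hmult ⟨1, by omega⟩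
  have h2 : (N : ℝ) * g ⟨2, by omega⟩ = N' * g ⟨2, by omega⟩ := by
    rw [← hN _ (by simp), ← hN' _ (by simp)]
  have hNN : (N : ℝ) = N' := mul_right_cancel₀ (hpos _).ne' h2
  apply hyS
  have : y = N • g := by
    funext k
    by_cases hk : k = ⟨0, by omega⟩
    · rw [hN' k (by simp [hk]), ← hNN]; simp
    · rw [hN k hk]; simp
  rw [this]
  exact nsmul_mem (heightOne_subset_simplexSemigroup hg) N

/-- In the cyclic case, a further lattice point of the simplex forces every height strictly between
`1` and `n - 1` to be attained twice. -/
theorem exists_pair_of_cyclic (hΛ : IsSimplexLattice Λ) (hn : 2 ≤ n)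
    (hpos : ∀ i, 0 < g i) (hg : g ∈ heightOne Λ) {u : Fin n → ℝ} (hu : u ∈ heightOne Λ)
    (hug : u ≠ g) (hu1 : ∀ i, u i < 1) (hucyc : u ∈ cyclicPart g) {k : ℕ} (hk2 : 2 ≤ k)
    (hk : k < n - 1) :
    ∃ x ∈ boxPts Λ, ∃ x' ∈ boxPts Λ, x ≠ x' ∧ boxHeight x = k ∧ boxHeight x' = k := by
  classical
  have hex := exists_pos_nsmul_isLatticePt hΛ hg.1
  obtain ⟨q, hqdef⟩ : ∃ q, q = Nat.find hex := ⟨_, rfl⟩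
  have hspec := Nat.find_spec hex
  rw [← hqdef] at hspec
  obtain ⟨hq, hqg⟩ := hspec
  have hmin : ∀ j, 0 < j → j < q → ¬ IsLatticePt (j • g) := fun j hj0 hj h =>
    Nat.find_min hex (hqdef ▸ hj) ⟨hj0, h⟩
  have hend : boxHeight ((q - 1) • g) = n - 1 := by
    rw [← boxHeight_neg_interior hn hpos hg.2.2]
    apply boxHeight_congr
    rw [sub_neg_eq_add, ← succ_nsmul, Nat.sub_add_cancel hq]
    exact hqg
  have hstep : ∀ m, boxHeight ((m + 1) • g) ≤ boxHeight (m • g) + 1 := fun m => by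
    simpa using hΛ.boxHeight_nsmul_add_step hg (zero_mem Λ) m
  have hg1 := lt_one_of_sum_eq_one hn hpos hg.2.2
  obtain ⟨p, hpq, hp⟩ := exists_nat_of_mem_cyclicPart hq hqg hucyc
  have hp2 : 2 ≤ p := by
    by_contra! h
    obtain rfl | rfl : p = 0 ∨ p = 1 := by omega
    · have h0 : u = 0 := isLatticePt_of_box (fun i => ⟨hu.2.1 i, hu1 i⟩) (by simpa using hp)
      have := hu.2.2
      simp [h0] at this
    · apply hug
      have := fracVec_congr (x := u) (y := g) (by simpa using hp)
      rwa [fracVec_eq_self fun i => ⟨hu.2.1 i, hu1 i⟩,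
        fracVec_eq_self fun i => ⟨(hpos i).le, hg1 i⟩] at this
  have hp1 : boxHeight (p • g) ≤ 1 := by
    rw [← boxHeight_congr hp]
    exact hΛ.boxHeight_le_one hu
  obtain ⟨m, -, hmq, hm⟩ := exists_eq_of_succ_le_add_one (f := fun m => boxHeight (m • g))
    hstep (Nat.zero_le (q - 1)) (k := k) (by simp [boxHeight]) (by simp only [hend]; omega)
  by_cases huniq : ∃ m' ≤ q - 1, m' ≠ m ∧ boxHeight (m' • g) = k
  · obtain ⟨m', hm'q, hne, hm'⟩ := huniq
    refine ⟨_, hΛ.fracVec_mem_boxPts (nsmul_mem hg.1 m), _,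
      hΛ.fracVec_mem_boxPts (nsmul_mem hg.1 m'), fun h => ?_, by
        rwa [IsSimplexLattice.boxHeight_fracVec], by rwa [IsSimplexLattice.boxHeight_fracVec]⟩
    have hdiff : IsLatticePt (m • g - m' • g) := by
      have h1 := (latticeGroup n).sub_mem (isLatticePt_sub_fracVec (m • g))
        (isLatticePt_sub_fracVec (m' • g))
      rw [h] at h1
      rw [mem_latticeGroup] at h1
      convert h1 using 1
      abel
    rcases lt_or_gt_of_ne hne with hlt | hlt
    · rw [sub_eq_add_neg, ← sub_nsmul _ hlt.le] at hdiff
      exact hmin _ (by omega) (by omega) hdiff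
    · have hdiff' := (latticeGroup n).neg_mem hdiff
      rw [mem_latticeGroup, neg_sub, sub_eq_add_neg, ← sub_nsmul _ hlt.le] at hdiff'
      exact hmin _ (by omega) (by omega) hdiff'
  · push Not at huniq
    exfalso
    have hlow : ∀ j < m, boxHeight (j • g) < k := by
      intro j hj
      by_contra! hge
      obtain ⟨i, -, hij, hi⟩ := exists_eq_of_succ_le_add_one (f := fun m => boxHeight (m • g))
        hstep (Nat.zero_le j) (k := k) (by simp [boxHeight]) hge
      exact huniq i (by omega) (by omega) hi
    have hhigh : ∀ j, m < j → j ≤ q - 1 → k < boxHeight (j • g) := by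
      intro j hj hjq
      by_contra! hle
      obtain ⟨i, hji, hiq, hi⟩ := exists_eq_of_succ_le_add_one
        (f := fun m => boxHeight (m • g)) hstep hjq (k := k) hle (by simp only [hend]; omega)
      exact huniq i hiq (by omega) hi
    have hpm : p < m := by
      by_contra! hle
      rcases hle.eq_or_lt with rfl | hlt
      · omega
      · have := hhigh p hlt (by omega)
        omega
    have hmlt : m < q - 1 := by
      refine lt_of_le_of_ne hmq fun h => ?_
      rw [h, hend] at hm
      omega
    have h1 := hhigh (m + 1) (by omega) (by omega)
    have h2 := hlow (m + 1 - p) (by omega)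
    have h3 := hΛ.boxHeight_add_le (nsmul_mem hg.1 (m + 1 - p)) (nsmul_mem hg.1 p)
    rw [← add_nsmul, Nat.sub_add_cancel (by omega)] at h3
    omega

/-- The lattice points of the box of height at least two. -/
def highBoxPts (Λ : AddSubgroup (Fin n → ℝ)) : Set (Fin n → ℝ) :=
  {x ∈ boxPts Λ | 2 ≤ boxHeight x}

theorem IsSimplexLattice.finite_highBoxPts (hΛ : IsSimplexLattice Λ) : (highBoxPts Λ).Finite :=
  hΛ.finite_box.subset (Set.sep_subset _ _)

theorem exists_boxPts_boxHeight (hΛ : IsSimplexLattice Λ) (hn : 2 ≤ n) (hg : g ∈ heightOne Λ)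
    (hpos : ∀ i, 0 < g i) {k : ℕ} (hk : k ≤ n - 1) : ∃ x ∈ boxPts Λ, boxHeight x = k := by
  obtain ⟨m, hm⟩ := exists_nsmul_boxHeight hΛ hn hg hpos hk
  exact ⟨_, hΛ.fracVec_mem_boxPts (nsmul_mem hg.1 m), by
    rwa [IsSimplexLattice.boxHeight_fracVec]⟩

theorem le_ncard_highBoxPts (hΛ : IsSimplexLattice Λ) (hn : 2 ≤ n) (hg : g ∈ heightOne Λ)
    (hpos : ∀ i, 0 < g i) {h : ℕ} (hh : h ≤ n - 1)
    (h2 : ∀ k, 2 ≤ k → k ≤ h →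
      ∃ x ∈ boxPts Λ, ∃ x' ∈ boxPts Λ, x ≠ x' ∧ boxHeight x = k ∧ boxHeight x' = k) :
    (n - 1 - 1) + (h - 1) ≤ (highBoxPts Λ).ncard := by
  rw [Set.ncard_eq_toFinset_card _ hΛ.finite_highBoxPts]
  refine le_card_of_fibers _ boxHeight hh (fun k hk2 hk => ?_) (fun k hk2 hk => ?_)
  · obtain ⟨x, hx, hxk⟩ := exists_boxPts_boxHeight hΛ hn hg hpos hk
    exact ⟨x, by simpa using ⟨hx, hxk ▸ hk2⟩, hxk⟩
  · obtain ⟨x, hx, x', hx', hne, hxk, hxk'⟩ := h2 k hk2 hk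
    exact ⟨x, by simpa using ⟨hx, hxk ▸ hk2⟩, x', by simpa using ⟨hx', hxk' ▸ hk2⟩, hne, hxk, hxk'⟩

/-- The heights of indecomposable bad points are controlled by the number of box points of height at
least two. -/
theorem le_ncard_of_indecomposable (hΛ : IsSimplexLattice Λ) (hva : VeryAmpleLattice Λ)
    (hn : 2 ≤ n) (hg : g ∈ heightOne Λ) (hpos : ∀ i, 0 < g i) {y : Fin n → ℝ} (hy : y ∈ Λ)
    (hy1 : ∀ i, 0 ≤ y i ∧ y i < 1) (hyS : y ∉ simplexSemigroup Λ) (hyi : Indecomposable Λ y) :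
    (n - 1 - 1) + (boxHeight y - 1) ≤ (highBoxPts Λ).ncard := by
  have hlt : ∀ c ∈ Λ, boxHeight c < n := fun c hc => hΛ.boxHeight_lt (by omega) hc
  have hylt := hlt y hy
  refine le_ncard_highBoxPts hΛ hn hg hpos (by omega) fun k hk2 hk => ?_
  have hsub : ∀ u ∈ heightOne Λ, boxHeight y ≤ boxHeight (y - u) := fun u hu =>
    hΛ.boxHeight_le_boxHeight_sub hy hy1 hu (hyi u hu)
  by_cases hall : ∀ u ∈ heightOne Λ, u ∈ cyclicPart g
  · rcases (show k ≤ n - 1 by omega).eq_or_lt with hkn | hkn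
    · have h1 := hsub g hg
      have h2 := hlt _ (sub_mem hy hg.1)
      refine ⟨y, ⟨hy, hy1⟩, _, hΛ.fracVec_mem_boxPts (sub_mem hy hg.1), fun h => ?_, by omega, by
        rw [IsSimplexLattice.boxHeight_fracVec]; omega⟩
      have h3 := isLatticePt_sub_fracVec (y - g)
      rw [← h, sub_sub_cancel_left] at h3
      have h4 := (latticeGroup n).neg_mem h3
      rw [neg_neg, mem_latticeGroup] at h4
      have h5 := isLatticePt_of_box (fun i =>
        ⟨(hpos i).le, lt_one_of_sum_eq_one hn hpos hg.2.2 i⟩) h4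
      have h6 := hpos ⟨0, by omega⟩
      simp [h5] at h6
    · obtain ⟨u, hu, hug, hu1⟩ := exists_heightOne_ne hva (by omega) hpos hg hy hy1 hyS
      exact exists_pair_of_cyclic hΛ hn hpos hg hu hug hu1 (hall u hu) hk2 hkn
  · push Not at hall
    obtain ⟨u, hu, hug⟩ := hall
    obtain ⟨c, hc, hcg, hck⟩ : ∃ c ∈ Λ, c ∉ cyclicPart g ∧ boxHeight y ≤ boxHeight c := by
      by_cases hyg : y ∈ cyclicPart g
      · refine ⟨y - u, sub_mem hy hu.1, fun h => hug ?_, hsub u hu⟩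
        simpa using sub_mem hyg h
      · exact ⟨y, hy, hyg, le_rfl⟩
    obtain ⟨x, hx, hxg, hxk⟩ := exists_not_mem_cyclicPart hΛ hva hg hc hcg (k := k)
      (by omega) (by omega)
    obtain ⟨m, hm⟩ := exists_nsmul_boxHeight hΛ hn hg hpos (k := k) (by omega)
    refine ⟨_, hΛ.fracVec_mem_boxPts hx, _, hΛ.fracVec_mem_boxPts (nsmul_mem hg.1 m),
      fun h => hxg ?_, by rwa [IsSimplexLattice.boxHeight_fracVec], by
        rwa [IsSimplexLattice.boxHeight_fracVec]⟩
    rw [mem_cyclicPart_congr (isLatticePt_sub_fracVec x), h,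
      ← mem_cyclicPart_congr (isLatticePt_sub_fracVec (m • g))]
    exact nsmul_mem_cyclicPart m

/-- The normality bound: lattice points of the cone of height greater than the number of box points
of height at least two are sums of height-one lattice points. -/
theorem mem_simplexSemigroup_of_lt (hΛ : IsSimplexLattice Λ) (hva : VeryAmpleLattice Λ)
    (hn : 2 ≤ n) (hg : g ∈ heightOne Λ) (hpos : ∀ i, 0 < g i) {x : Fin n → ℝ} (hx : x ∈ Λ)
    (hx0 : ∀ i, 0 ≤ x i) {K : ℕ} (hsum : ∑ i, x i = K) (hK : (highBoxPts Λ).ncard < K) :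
    x ∈ simplexSemigroup Λ := by
  by_contra hxS
  have hxsplit : x = fracVec x + fun i => ((⌊x i⌋₊ : ℕ) : ℝ) := by
    funext i
    simp only [fracVec, Pi.add_apply]
    rw [natCast_floor_eq_intCast_floor (hx0 i), Int.fract_add_floor]
  have hb := hΛ.fracVec_mem hx
  have hb0 : ∀ i, 0 ≤ fracVec x i := fun i => Int.fract_nonneg _
  have hb1 : ∀ i, fracVec x i < 1 := fun i => Int.fract_lt_one _
  have hfloor := hΛ.natVec_mem_simplexSemigroup fun i => ⌊x i⌋₊
  have hbS : fracVec x ∉ simplexSemigroup Λ := fun h => hxS (hxsplit ▸ add_mem h hfloor)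
  obtain ⟨y, hy, hy0, hyS, hyi, hby⟩ := exists_indecomposable (boxHeight x) (fracVec x) hb hb0
    (hΛ.boxHeight_cast hx).symm hbS
  have hy1 : ∀ i, y i < 1 := fun i => by
    have h1 := (mem_and_nonneg_of_mem_simplexSemigroup hby).2 i
    have h2 := hb1 i
    simp only [Pi.sub_apply] at h1
    linarith
  have hcount := le_ncard_of_indecomposable hΛ hva hn hg hpos hy (fun i => ⟨hy0 i, hy1 i⟩) hyS hyi
  have hfew : ∑ i, ⌊x i⌋₊ + 1 < boxHeight y := by
    by_contra! hle
    have h1 := hΛ.add_natVec_mem hva (boxHeight y) y hy hy0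
      (hΛ.boxHeight_of_box hy fun i => ⟨hy0 i, hy1 i⟩).symm _ hle
    apply hxS
    have h2 := add_mem h1 hby
    rw [hxsplit]
    convert h2 using 1
    abel
  have hlt := hΛ.boxHeight_lt (by omega) hx
  have hKsum : K = boxHeight x + ∑ i, ⌊x i⌋₊ := by
    have h1 : (K : ℝ) = boxHeight x + ∑ i, ((⌊x i⌋₊ : ℕ) : ℝ) := by
      rw [← hsum, hΛ.boxHeight_cast hx, ← Finset.sum_add_distrib]
      exact Finset.sum_congr rfl fun i _ => congrFun hxsplit i
    exact_mod_cast h1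
  omega

end Counting

section Volume

/-- The corner simplex cut out of the positive orthant by `∑ x i ≤ 1`. -/
def cornerSimplex (d : ℕ) : Set (Fin d → ℝ) := {x | (∀ i, 0 ≤ x i) ∧ ∑ i, x i ≤ 1}

theorem measurableSet_cornerSimplex (d : ℕ) : MeasurableSet (cornerSimplex d) := by
  refine IsClosed.measurableSet ?_
  simp only [cornerSimplex, Set.ofPred_and, Set.ofPred_forall]
  exact (isClosed_iInter fun i => isClosed_le (by fun_prop) (by fun_prop)).inter
    (isClosed_le (by fun_prop) (by fun_prop))

theorem measurePreserving_signs {d : ℕ} (s : Fin d → Bool) :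
    MeasurePreserving (fun (x : Fin d → ℝ) i => if s i then x i else -x i) volume volume := by
  refine volume_preserving_pi (f := fun i (y : ℝ) => if s i then y else -y) fun i => ?_
  cases s i
  · simpa using Measure.measurePreserving_neg (volume : Measure ℝ)
  · simpa using! MeasurePreserving.id (volume : Measure ℝ)

theorem inv_factorial_le_volume_cornerSimplex {d : ℕ} (hd : 0 < d) :
    ENNReal.ofReal (d.factorial : ℝ)⁻¹ ≤ volume (cornerSimplex d) := by
  have : Nonempty (Fin d) := ⟨⟨0, hd⟩⟩
  have hC := volume_sum_rpow_le (Fin d) (p := 1) le_rfl 1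
  have hG : Real.Gamma ((d : ℝ) + 1) = d.factorial := Real.Gamma_nat_eq_factorial d
  have hG2 : Real.Gamma (1 + 1) = 1 := by simpa using Real.Gamma_nat_eq_factorial 1
  simp only [Real.rpow_one, div_one, Fintype.card_fin, ENNReal.ofReal_one, one_pow, one_mul, hG,
    hG2, mul_one] at hC
  have hcover : {x : Fin d → ℝ | ∑ i, |x i| ≤ 1} ⊆
      ⋃ s : Fin d → Bool, (fun (x : Fin d → ℝ) i => if s i then x i else -x i) ⁻¹'
        cornerSimplex d := by
    intro x hx
    refine Set.mem_iUnion.2 ⟨fun i => decide (0 ≤ x i), ?_⟩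
    have habs : (fun i => if decide (0 ≤ x i) = true then x i else -x i) = fun i => |x i| := by
      ext i
      by_cases h : 0 ≤ x i
      · simp [h, abs_of_nonneg]
      · simp [h, abs_of_neg (not_le.1 h)]
    rw [Set.mem_preimage, habs]
    exact ⟨fun i => abs_nonneg _, hx⟩
  have hle : ENNReal.ofReal (2 ^ d / d.factorial) ≤ 2 ^ d * volume (cornerSimplex d) := by
    rw [← hC]
    refine (measure_mono hcover).trans ((measure_iUnion_fintype_le _ _).trans ?_)
    simp only [(measurePreserving_signs _).measure_preimage
      (measurableSet_cornerSimplex d).nullMeasurableSet]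
    simp
  have h2 : ENNReal.ofReal (2 ^ d / d.factorial) = 2 ^ d * ENNReal.ofReal (d.factorial : ℝ)⁻¹ := by
    rw [div_eq_mul_inv, ENNReal.ofReal_mul (by positivity), ENNReal.ofReal_pow (by norm_num)]
    simp
  rw [h2] at hle
  exact (ENNReal.mul_le_mul_iff_right (by simp) (by finiteness)).1 hle

/-- The vectors joining vertex `0` of a simplex to the other vertices. -/
def edgeVec {d : ℕ} (v : Fin (d + 1) → Fin d → ℝ) (i : Fin d) : Fin d → ℝ := v i.succ - v 0

theorem abs_det_edgeVec_le_nVol {d : ℕ} (hd : 0 < d) (v : Fin (d + 1) → Fin d → ℝ) :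
    |(Matrix.of (edgeVec v)).det| ≤ nVol (convexHull ℝ (Set.range v)) := by
  set T : (Fin d → ℝ) →ₗ[ℝ] (Fin d → ℝ) := Matrix.toLin' (Matrix.of (edgeVec v)).transpose with hT
  have hdet : LinearMap.det T = (Matrix.of (edgeVec v)).det := by
    rw [hT, LinearMap.det_toLin', Matrix.det_transpose]
  have hTx (x : Fin d → ℝ) : T x = ∑ i, x i • edgeVec v i := by
    ext j
    simp [hT, Matrix.mulVec, dotProduct, mul_comm]
  have hsub : (fun x => v 0 + x) '' (T '' cornerSimplex d) ⊆ convexHull ℝ (Set.range v) := by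
    rintro _ ⟨_, ⟨x, ⟨hx0, hx1⟩, rfl⟩, rfl⟩
    have h := (convex_convexHull ℝ (Set.range v)).sum_mem (t := Finset.univ)
      (w := Fin.cons (1 - ∑ i, x i) x) (z := v)
      (fun i _ => by
        refine Fin.cases ?_ (fun j => ?_) i
        · simpa using hx1
        · simpa using hx0 j)
      (by simp [Fin.sum_univ_succ])
      (fun i _ => subset_convexHull ℝ _ (Set.mem_range_self i))
    convert h using 1
    simp only [hTx, edgeVec, smul_sub, Finset.sum_sub_distrib, ← Finset.sum_smul,
      Fin.sum_univ_succ, Fin.cons_zero, Fin.cons_succ, sub_smul, one_smul]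
    abel
  have hfin : volume (convexHull ℝ (Set.range v)) ≠ ⊤ :=
    ((Set.finite_range v).isCompact_convexHull ℝ).measure_lt_top.ne
  have hvol : ENNReal.ofReal (|(Matrix.of (edgeVec v)).det| * (d.factorial : ℝ)⁻¹) ≤
      volume (convexHull ℝ (Set.range v)) := by
    refine le_trans ?_ (measure_mono hsub)
    rw [Set.image_add_left, measure_preimage_add, Measure.addHaar_image_linearMap, hdet,
      ENNReal.ofReal_mul (abs_nonneg _)]
    gcongr
    exact inv_factorial_le_volume_cornerSimplex hd
  have h := (ENNReal.ofReal_le_iff_le_toReal hfin).1 hvol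
  rw [← div_eq_mul_inv, div_le_iff₀ (by positivity)] at h
  rw [nVol]
  linarith

end Volume

section BarycentricLattice

variable {d : ℕ}

/-- The group of coordinate vectors `t` with integral sum for which `∑ t i • v i` is a lattice
point. -/
def baryLattice (v : Fin (d + 1) → Fin d → ℝ) : AddSubgroup (Fin (d + 1) → ℝ) where
  carrier := {t | IsLatticePt (Fintype.linearCombination ℝ v t) ∧ ∃ z : ℤ, ∑ i, t i = z}
  zero_mem' := ⟨by rw [map_zero]; exact (latticeGroup d).zero_mem, 0, by simp⟩
  add_mem' := by
    rintro s t ⟨hs, y, hy⟩ ⟨ht, z, hz⟩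
    refine ⟨by rw [map_add]; exact (latticeGroup d).add_mem hs ht, y + z, ?_⟩
    simp [Finset.sum_add_distrib, hy, hz]
  neg_mem' := by
    rintro t ⟨ht, z, hz⟩
    exact ⟨by rw [map_neg]; exact (latticeGroup d).neg_mem ht, -z, by simp [hz]⟩

theorem linearIndependent_edgeVec {v : Fin (d + 1) → Fin d → ℝ} (hind : AffineIndependent ℝ v) :
    LinearIndependent ℝ (edgeVec v) := by
  have h := (affineIndependent_iff_linearIndependent_vsub ℝ v 0).1 hind
  exact h.comp (fun i : Fin d => ⟨i.succ, Fin.succ_ne_zero i⟩)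
    fun i j hij => Fin.succ_injective _ (congrArg Subtype.val hij)

open Classical in
/-- The edge vectors at vertex `0` of a full-dimensional simplex, as a basis. -/
noncomputable def edgeBasis {v : Fin (d + 1) → Fin d → ℝ} (hind : AffineIndependent ℝ v) :
    Module.Basis (Fin d) ℝ (Fin d → ℝ) :=
  basisOfPiSpaceOfLinearIndependent (linearIndependent_edgeVec hind)

theorem coe_edgeBasis {v : Fin (d + 1) → Fin d → ℝ} (hind : AffineIndependent ℝ v) :
    ⇑(edgeBasis hind) = edgeVec v := by
  classical
  exact coe_basisOfPiSpaceOfLinearIndependent (linearIndependent_edgeVec hind)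

theorem linearCombination_sub_smul (v : Fin (d + 1) → Fin d → ℝ) (t : Fin (d + 1) → ℝ) :
    Fintype.linearCombination ℝ v t - (∑ i, t i) • v 0 = ∑ i : Fin d, t i.succ • edgeVec v i := by
  simp only [Fintype.linearCombination_apply, edgeVec, smul_sub, Finset.sum_sub_distrib,
    ← Finset.sum_smul, Fin.sum_univ_succ, add_smul]
  abel

theorem edgeBasis_repr {v : Fin (d + 1) → Fin d → ℝ} (hind : AffineIndependent ℝ v)
    (t : Fin (d + 1) → ℝ) (i : Fin d) :
    (edgeBasis hind).repr (Fintype.linearCombination ℝ v t - (∑ i, t i) • v 0) i = t i.succ := by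
  rw [linearCombination_sub_smul, ← coe_edgeBasis hind, Module.Basis.repr_sum_self]

theorem eq_of_linearCombination_eq {v : Fin (d + 1) → Fin d → ℝ} (hind : AffineIndependent ℝ v)
    {s t : Fin (d + 1) → ℝ}
    (h : Fintype.linearCombination ℝ v s = Fintype.linearCombination ℝ v t)
    (hsum : ∑ i, s i = ∑ i, t i) : s = t := by
  have hsucc (i : Fin d) : s i.succ = t i.succ := by
    rw [← edgeBasis_repr hind s, ← edgeBasis_repr hind t, h, hsum]
  ext i
  refine Fin.cases ?_ hsucc i
  simpa [Fin.sum_univ_succ, hsucc] using hsum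

/-- The lattice point attached to a coordinate vector after translating vertex `0` to the
origin. -/
theorem isLatticePt_sub_smul {v : Fin (d + 1) → Fin d → ℝ} (h0 : IsLatticePt (v 0))
    {t : Fin (d + 1) → ℝ} (ht : t ∈ baryLattice v) :
    IsLatticePt (Fintype.linearCombination ℝ v t - (∑ i, t i) • v 0) := by
  obtain ⟨h, z, hz⟩ := ht
  rw [hz, Int.cast_smul_eq_zsmul]
  exact (latticeGroup d).sub_mem h ((latticeGroup d).zsmul_mem h0 z)

theorem latticeGroup_eq_span :
    latticeGroup d = (Submodule.span ℤ (Set.range (Pi.basisFun ℝ (Fin d)))).toAddSubgroup := by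
  ext x
  rw [Submodule.mem_toAddSubgroup, Module.Basis.mem_span_iff_repr_mem, mem_latticeGroup]
  simp [IsLatticePt, eq_comm]

theorem relIndex_span_edgeBasis {v : Fin (d + 1) → Fin d → ℝ} (hlat : ∀ i, IsLatticePt (v i))
    (hind : AffineIndependent ℝ v) :
    ((Submodule.span ℤ (Set.range (edgeBasis hind))).toAddSubgroup.relIndex (latticeGroup d) : ℝ) =
      |(Matrix.of (edgeVec v)).det| := by
  have hle : Submodule.span ℤ (Set.range (edgeBasis hind)) ≤
      Submodule.span ℤ (Set.range (Pi.basisFun ℝ (Fin d))) := by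
    rw [Submodule.span_le]
    rintro _ ⟨i, rfl⟩
    have h : edgeVec v i ∈ latticeGroup d := (latticeGroup d).sub_mem (hlat _) (hlat _)
    rw [latticeGroup_eq_span] at h
    rwa [coe_edgeBasis]
  have hcov (b : Module.Basis (Fin d) ℝ (Fin d → ℝ)) :
      ZLattice.covolume (Submodule.span ℤ (Set.range b)) = |(Matrix.of b).det| := by
    rw [ZLattice.covolume_eq_measure_fundamentalDomain _ _ (ZSpan.isAddFundamentalDomain b _),
      ZSpan.volume_real_fundamentalDomain]
  have h := ZLattice.covolume_div_covolume_eq_relIndex _ _ hle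
  have h1 : Matrix.of (Pi.basisFun ℝ (Fin d)) = 1 := by
    ext i j
    simp [Matrix.one_apply, Pi.single_apply, eq_comm]
  rw [hcov, hcov, h1, Matrix.det_one, abs_one, div_one, ← latticeGroup_eq_span] at h
  rw [← coe_edgeBasis hind]
  exact h.symm

theorem exists_injective_boxPts_baryLattice {v : Fin (d + 1) → Fin d → ℝ}
    (hlat : ∀ i, IsLatticePt (v i)) (hind : AffineIndependent ℝ v) :
    ∃ f : boxPts (baryLattice v) → latticeGroup d ⧸
        (Submodule.span ℤ (Set.range (edgeBasis hind))).toAddSubgroup.addSubgroupOf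
          (latticeGroup d), Function.Injective f := by
  refine ⟨fun t => QuotientAddGroup.mk ⟨_, isLatticePt_sub_smul (hlat 0) t.2.1⟩, ?_⟩
  rintro ⟨s, hs, hsb⟩ ⟨t, ht, htb⟩ hst
  rw [QuotientAddGroup.eq, AddSubgroup.mem_addSubgroupOf, Submodule.mem_toAddSubgroup,
    Module.Basis.mem_span_iff_repr_mem] at hst
  have hinteg {x y : ℝ} (hx : 0 ≤ x ∧ x < 1) (hy : 0 ≤ y ∧ y < 1) (z : ℤ) (hz : z = -x + y) :
      x = y := by
    have h1 : (z : ℝ) < 1 := by linarith [hx.1, hy.2]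
    have h2 : (-1 : ℝ) < z := by linarith [hx.2, hy.1]
    have h3 : z = 0 := by
      have h1' : z < 1 := by exact_mod_cast h1
      have h2' : -1 < z := by exact_mod_cast h2
      omega
    rw [h3] at hz
    push_cast at hz
    linarith
  have hsucc (i : Fin d) : s i.succ = t i.succ := by
    obtain ⟨z, hz⟩ := hst i
    simp only [AddSubgroup.coe_add, AddSubgroup.coe_neg, map_add, map_neg, Finsupp.add_apply,
      Finsupp.neg_apply, edgeBasis_repr] at hz
    exact hinteg (hsb _) (htb _) z (by simpa using hz)
  have h0 : s 0 = t 0 := by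
    obtain ⟨-, y, hy⟩ := hs
    obtain ⟨-, z, hz⟩ := ht
    refine hinteg (hsb _) (htb _) (z - y) ?_
    push_cast
    rw [← hy, ← hz, Fin.sum_univ_succ, Fin.sum_univ_succ]
    simp only [hsucc]
    ring
  exact Subtype.ext (funext fun i => Fin.cases h0 hsucc i)

theorem finite_boxPts_baryLattice {v : Fin (d + 1) → Fin d → ℝ}
    (hlat : ∀ i, IsLatticePt (v i)) (hind : AffineIndependent ℝ v) :
    (boxPts (baryLattice v)).Finite ∧
      ((boxPts (baryLattice v)).ncard : ℝ) ≤ |(Matrix.of (edgeVec v)).det| := by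
  obtain ⟨f, hf⟩ := exists_injective_boxPts_baryLattice hlat hind
  have hidx := relIndex_span_edgeBasis hlat hind
  have hne : (Matrix.of (edgeVec v)).det ≠ 0 :=
    (Matrix.linearIndependent_rows_iff_isUnit.1 (linearIndependent_edgeVec hind)).map
      Matrix.detMonoidHom |>.ne_zero
  have hne' : Nat.card (latticeGroup d ⧸
      (Submodule.span ℤ (Set.range (edgeBasis hind))).toAddSubgroup.addSubgroupOf
        (latticeGroup d)) ≠ 0 := by
    intro h
    have h' : (Submodule.span ℤ (Set.range (edgeBasis hind))).toAddSubgroup.relIndex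
        (latticeGroup d) = 0 := h
    rw [h', Nat.cast_zero, eq_comm, abs_eq_zero] at hidx
    exact hne hidx
  have hfin := Nat.finite_of_card_ne_zero hne'
  refine ⟨Set.finite_coe_iff.1 (Finite.of_injective f hf), ?_⟩
  rw [← hidx]
  exact_mod_cast Nat.card_le_card_of_injective f hf

theorem isSimplexLattice_baryLattice {v : Fin (d + 1) → Fin d → ℝ}
    (hlat : ∀ i, IsLatticePt (v i)) (hind : AffineIndependent ℝ v) :
    IsSimplexLattice (baryLattice v) where
  single_mem i := ⟨by simpa using hlat i, 1, by simp⟩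
  sum_int _ hx := hx.2
  finite_box := (finite_boxPts_baryLattice hlat hind).1

end BarycentricLattice

section SimplexGeometry

variable {d : ℕ} {v : Fin (d + 1) → Fin d → ℝ}

theorem mem_convexHull_range_iff (v : Fin (d + 1) → Fin d → ℝ) (x : Fin d → ℝ) :
    x ∈ convexHull ℝ (Set.range v) ↔
      ∃ w : Fin (d + 1) → ℝ, (∀ i, 0 ≤ w i) ∧ ∑ i, w i = 1 ∧
        Fintype.linearCombination ℝ v w = x := by
  have hr : Set.range v = Fintype.linearCombination ℝ v ''
      Set.range fun i : Fin (d + 1) => (Pi.single i 1 : Fin (d + 1) → ℝ) := by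
    rw [← Set.range_comp]
    congr 1
    ext i j
    simp
  rw [hr, ← LinearMap.image_convexHull, convexHull_rangle_single_eq_stdSimplex]
  simp [stdSimplex, and_assoc]

theorem mem_heightOne_of_mem_latticePts {x : Fin d → ℝ}
    (hx : x ∈ latticePts (convexHull ℝ (Set.range v))) :
    ∃ t ∈ heightOne (baryLattice v), Fintype.linearCombination ℝ v t = x := by
  obtain ⟨w, hw0, hw1, rfl⟩ := (mem_convexHull_range_iff v x).1 hx.1
  exact ⟨w, ⟨⟨hx.2, 1, by simpa using hw1⟩, hw0, hw1⟩, rfl⟩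

theorem linearCombination_mem_latticePts {t : Fin (d + 1) → ℝ}
    (ht : t ∈ heightOne (baryLattice v)) :
    Fintype.linearCombination ℝ v t ∈ latticePts (convexHull ℝ (Set.range v)) :=
  ⟨(mem_convexHull_range_iff v _).2 ⟨t, ht.2.1, ht.2.2, rfl⟩, ht.1.1⟩

theorem vertex_mem_extremePoints (hind : AffineIndependent ℝ v) (i : Fin (d + 1)) :
    v i ∈ (convexHull ℝ (Set.range v)).extremePoints ℝ := by
  refine ⟨subset_convexHull ℝ _ (Set.mem_range_self i), ?_⟩
  intro x hx y hy hxy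
  obtain ⟨s, hs0, hs1, rfl⟩ := (mem_convexHull_range_iff v x).1 hx
  obtain ⟨t, ht0, ht1, rfl⟩ := (mem_convexHull_range_iff v y).1 hy
  obtain ⟨a, b, ha, hb, hab, h⟩ := hxy
  have hst : a • s + b • t = Pi.single i 1 := by
    refine eq_of_linearCombination_eq hind (by simpa using h) ?_
    simp [Finset.sum_add_distrib, ← Finset.mul_sum, hs1, ht1, hab]
  have hzero (j : Fin (d + 1)) (hj : j ≠ i) : s j = 0 := by
    have hj' := congrFun hst j
    simp only [Pi.add_apply, Pi.smul_apply, smul_eq_mul, Pi.single_eq_of_ne hj] at hj'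
    nlinarith [mul_nonneg ha.le (hs0 j), mul_nonneg hb.le (ht0 j), hs0 j]
  have hsi : s i = 1 := by
    rw [← hs1, Finset.sum_eq_single i (fun j _ hj => hzero j hj) (by simp)]
  have hs : s = Pi.single i 1 := by
    ext j
    by_cases hj : j = i
    · rw [hj, hsi, Pi.single_eq_same]
    · rw [hzero j hj, Pi.single_eq_of_ne hj]
  simp [hs]

theorem veryAmpleLattice_baryLattice (hlat : ∀ i, IsLatticePt (v i)) (hind : AffineIndependent ℝ v)
    (hva : IsVeryAmple (convexHull ℝ (Set.range v))) : VeryAmpleLattice (baryLattice v) := by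
  intro i t ht ht0
  obtain ⟨h, hh⟩ := (isSimplexLattice_baryLattice hlat hind).exists_nat_sum ht ht0
  have hlatt : IsLatticePt (Fintype.linearCombination ℝ v t - (h : ℝ) • v i) := by
    rw [Nat.cast_smul_eq_nsmul]
    exact (latticeGroup d).sub_mem ht.1 ((latticeGroup d).nsmul_mem (hlat i) h)
  have hcone : Fintype.linearCombination ℝ v t - (h : ℝ) • v i ∈
      coneOver ((fun p => p - v i) '' convexHull ℝ (Set.range v)) := by
    rcases Nat.eq_zero_or_pos h with rfl | hpos
    · have ht' : t = 0 := by
        ext j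
        exact (Finset.sum_eq_zero_iff_of_nonneg fun j _ => ht0 j).1 (by simpa using hh) j
          (Finset.mem_univ j)
      exact ⟨0, _, ⟨v i, subset_convexHull ℝ _ (Set.mem_range_self i), rfl⟩, le_rfl, by simp [ht']⟩
    · have hne : (h : ℝ) ≠ 0 := by positivity
      refine ⟨h, _, ⟨(h : ℝ)⁻¹ • Fintype.linearCombination ℝ v t, ?_, rfl⟩, by positivity, ?_⟩
      · rw [← map_smul]
        refine (mem_convexHull_range_iff v _).2 ⟨_, fun j => ?_, ?_, rfl⟩
        · exact mul_nonneg (by positivity) (ht0 j)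
        · simp [← Finset.mul_sum, hh, hne]
      · rw [smul_sub, smul_inv_smul₀ hne]
  obtain ⟨m, u, hu, hsum⟩ := hva _ (vertex_mem_extremePoints hind i) _ hlatt hcone
  choose s hs hsu using fun j => mem_heightOne_of_mem_latticePts (hu j)
  have key : t + m • Pi.single i (1 : ℝ) = ∑ j, s j + h • Pi.single i (1 : ℝ) := by
    refine eq_of_linearCombination_eq hind ?_ ?_
    · rw [map_add, map_add, map_sum, map_nsmul, map_nsmul]
      simp only [hsu, Fintype.linearCombination_apply_single, one_smul]
      rw [Finset.sum_sub_distrib, Finset.sum_const, Finset.card_univ, Fintype.card_fin,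
        Nat.cast_smul_eq_nsmul] at hsum
      rw [← sub_eq_sub_iff_add_eq_add, hsum]
    · simp only [Pi.add_apply, Finset.sum_add_distrib, hh, Finset.sum_apply, Pi.smul_apply,
        ← Finset.smul_sum]
      rw [Finset.sum_comm]
      simp [(hs _).2.2, add_comm]
  refine ⟨m, ?_⟩
  rw [key]
  exact add_mem (sum_mem fun j _ => heightOne_subset_simplexSemigroup (hs j))
    (nsmul_mem (heightOne_subset_simplexSemigroup
      ((isSimplexLattice_baryLattice hlat hind).single_mem_heightOne i)) h)

theorem exists_pos_heightOne (hind : AffineIndependent ℝ v) {x : Fin d → ℝ}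
    (hx : x ∈ latticePts (interior (convexHull ℝ (Set.range v)))) :
    ∃ g ∈ heightOne (baryLattice v), ∀ i, 0 < g i := by
  let b : AffineBasis (Fin (d + 1)) ℝ (Fin d → ℝ) :=
    ⟨v, hind, hind.affineSpan_eq_top_iff_card_eq_finrank_add_one.2 (by simp)⟩
  have hpos : ∀ i, 0 < b.coord i x := by
    have h := hx.1
    change x ∈ interior (convexHull ℝ (Set.range b)) at h
    rwa [b.interior_convexHull] at h
  have hsum : ∑ i, b.coord i x = 1 := b.sum_coord_apply_eq_one x
  have hcomb : Fintype.linearCombination ℝ v (fun i => b.coord i x) = x := by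
    rw [Fintype.linearCombination_apply]
    exact b.linear_combination_coord_eq_self x
  exact ⟨fun i => b.coord i x, ⟨⟨by rw [hcomb]; exact hx.2, 1, by simp⟩,
    fun i => (hpos i).le, hsum⟩, hpos⟩

theorem isKNormal_of_lt (hlat : ∀ i, IsLatticePt (v i)) (hind : AffineIndependent ℝ v)
    (hva : IsVeryAmple (convexHull ℝ (Set.range v))) (hd : 0 < d) {g : Fin (d + 1) → ℝ}
    (hg : g ∈ heightOne (baryLattice v)) (hpos : ∀ i, 0 < g i) {k : ℕ}
    (hk : (highBoxPts (baryLattice v)).ncard < k) :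
    IsKNormal (convexHull ℝ (Set.range v)) k := by
  rintro x ⟨⟨p, hp, rfl⟩, hx⟩
  obtain ⟨w, hw0, hw1, rfl⟩ := (mem_convexHull_range_iff v p).1 hp
  have hsum : ∑ i, ((k : ℝ) • w) i = k := by simp [← Finset.mul_sum, hw1]
  have hmem : (k : ℝ) • w ∈ baryLattice v :=
    ⟨by rw [map_smul]; exact hx, k, by rw [hsum, Int.cast_natCast]⟩
  obtain ⟨s, hs, hsw⟩ := exists_multiset_of_mem_simplexSemigroup <|
    mem_simplexSemigroup_of_lt (isSimplexLattice_baryLattice hlat hind)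
      (veryAmpleLattice_baryLattice hlat hind hva) (by omega) hg hpos hmem
      (fun i => mul_nonneg (Nat.cast_nonneg k) (hw0 i)) hsum hk
  induction s using Quotient.inductionOn with | _ l
  rw [Multiset.quot_mk_to_coe, Multiset.sum_coe, ← Fin.sum_univ_getElem] at hsw
  have hl : ∀ j : Fin l.length, l[j] ∈ heightOne (baryLattice v) := fun j =>
    hs _ (Multiset.mem_coe.2 (l.getElem_mem j.2))
  have hcard : l.length = k := by
    rw [← hsw] at hsum
    simp only [Finset.sum_apply] at hsum
    rw [Finset.sum_comm] at hsum
    have h1 : ∀ j : Fin l.length, ∑ i, l[j] i = 1 := fun j => (hl j).2.2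
    simp only [Fin.getElem_fin] at h1
    simp only [h1] at hsum
    simpa using hsum
  subst hcard
  refine ⟨fun j => Fintype.linearCombination ℝ v l[j],
    fun j => linearCombination_mem_latticePts (hl j), ?_⟩
  rw [← map_sum]
  simp only [Fin.getElem_fin]
  rw [hsw, map_smul]

theorem ncard_latticePts_add_le (hlat : ∀ i, IsLatticePt (v i)) (hind : AffineIndependent ℝ v) :
    (latticePts (convexHull ℝ (Set.range v))).ncard + (highBoxPts (baryLattice v)).ncard ≤
      (boxPts (baryLattice v)).ncard + d := by
  have hΛ := isSimplexLattice_baryLattice hlat hind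
  set Λ := baryLattice v
  have hsub : heightOne Λ ⊆ {t ∈ boxPts Λ | ∑ i, t i = 1} ∪
      Set.range fun i : Fin (d + 1) => (Pi.single i 1 : Fin (d + 1) → ℝ) := by
    rintro t ⟨ht, ht0, ht1⟩
    by_cases h : ∀ i, t i < 1
    · exact Or.inl ⟨⟨ht, fun i => ⟨ht0 i, h i⟩⟩, ht1⟩
    · right
      push Not at h
      obtain ⟨i, hi⟩ := h
      have hsplit := Finset.add_sum_erase Finset.univ t (Finset.mem_univ i)
      have hnn : 0 ≤ ∑ j ∈ Finset.univ.erase i, t j := Finset.sum_nonneg fun j _ => ht0 j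
      refine ⟨i, ?_⟩
      ext j
      by_cases hj : j = i
      · simp only [hj, Pi.single_eq_same]
        linarith
      · simp only [Pi.single_eq_of_ne hj]
        exact ((Finset.sum_eq_zero_iff_of_nonneg fun j _ => ht0 j).1 (by linarith) j
          (by simp [hj])).symm
  have hfin1 : {t ∈ boxPts Λ | ∑ i, t i = 1}.Finite := hΛ.finite_box.subset fun _ h => h.1
  have hpts : (latticePts (convexHull ℝ (Set.range v))).ncard ≤
      {t ∈ boxPts Λ | ∑ i, t i = 1}.ncard + (d + 1) := by
    have himg : latticePts (convexHull ℝ (Set.range v)) ⊆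
        Fintype.linearCombination ℝ v '' heightOne Λ := fun x hx =>
      mem_heightOne_of_mem_latticePts hx
    have hfin := hfin1.union (Set.finite_range
      fun i : Fin (d + 1) => (Pi.single i 1 : Fin (d + 1) → ℝ))
    calc _ ≤ (Fintype.linearCombination ℝ v '' heightOne Λ).ncard :=
          Set.ncard_le_ncard himg ((hfin.subset hsub).image _)
      _ ≤ (heightOne Λ).ncard := Set.ncard_image_le (hfin.subset hsub)
      _ ≤ _ := Set.ncard_le_ncard hsub hfin
      _ ≤ _ := Set.ncard_union_le _ _
      _ ≤ _ := by
        gcongr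
        rw [← Set.image_univ]
        exact (Set.ncard_image_le Set.finite_univ).trans (by simp)
  have hdisj1 : Disjoint {t ∈ boxPts Λ | ∑ i, t i = 1} (highBoxPts Λ) := by
    rw [Set.disjoint_left]
    rintro t ⟨ht, ht1⟩ ⟨-, h2⟩
    have h := hΛ.boxHeight_of_box ht.1 ht.2
    rw [ht1] at h
    have h' : boxHeight t = 1 := by exact_mod_cast h
    omega
  have hzero : (0 : Fin (d + 1) → ℝ) ∉ {t ∈ boxPts Λ | ∑ i, t i = 1} ∪ highBoxPts Λ := by
    rintro (⟨-, h⟩ | ⟨-, h⟩)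
    · simp at h
    · simp [boxHeight] at h
  have hins : insert 0 ({t ∈ boxPts Λ | ∑ i, t i = 1} ∪ highBoxPts Λ) ⊆ boxPts Λ := by
    rintro t (rfl | h | h)
    · exact ⟨Λ.zero_mem, by simp⟩
    · exact h.1
    · exact h.1
  have hle := Set.ncard_le_ncard hins hΛ.finite_box
  rw [Set.ncard_insert_of_notMem hzero (hfin1.union hΛ.finite_highBoxPts),
    Set.ncard_union_eq hdisj1 hfin1 hΛ.finite_highBoxPts] at hle
  omega

end SimplexGeometry

/-- the Eisenbud–Goto bound holds for very ample Fano simplices. -/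
theorem stmt8 {d : ℕ} (v : Fin (d + 1) → Fin d → ℝ)
    (hlat : ∀ i, IsLatticePt (v i)) (hind : AffineIndependent ℝ v)
    (hva : IsVeryAmple (convexHull ℝ (Set.range v)))
    (hfano : latticePts (interior (convexHull ℝ (Set.range v))) = {0})
    (hprim : ∀ i, ∃ w : Fin d → ℤ, (∀ j, v i j = (w j : ℝ)) ∧ Finset.univ.gcd w = 1) :
    (max (kNormality (convexHull ℝ (Set.range v)))
        (polyDeg (convexHull ℝ (Set.range v))) : ℝ) ≤
      nVol (convexHull ℝ (Set.range v)) -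
        (latticePts (convexHull ℝ (Set.range v))).ncard + d + 1 := by
  have hd : 0 < d := by
    rcases Nat.eq_zero_or_pos d with rfl | h
    · obtain ⟨w, -, hw⟩ := hprim 0
      simp at hw
    · exact h
  have hzero : (0 : Fin d → ℝ) ∈ latticePts (interior (convexHull ℝ (Set.range v))) := by
    rw [hfano]
    exact Set.mem_singleton 0
  obtain ⟨g, hg, hpos⟩ := exists_pos_heightOne hind hzero
  have hk : kNormality (convexHull ℝ (Set.range v)) ≤ (highBoxPts (baryLattice v)).ncard + 1 :=
    Nat.sInf_le ⟨Nat.succ_pos _, fun k hk => isKNormal_of_lt hlat hind hva hd hg hpos hk⟩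
  have hdeg : polyDeg (convexHull ℝ (Set.range v)) ≤ (highBoxPts (baryLattice v)).ncard + 1 := by
    have h := le_ncard_highBoxPts (isSimplexLattice_baryLattice hlat hind) (by omega) hg hpos
      (h := 1) (by omega) (by omega)
    rw [polyDeg, if_pos ⟨0, hzero⟩]
    omega
  have hcount := ncard_latticePts_add_le hlat hind
  have hvol := (finite_boxPts_baryLattice hlat hind).2.trans (abs_det_edgeVec_le_nVol hd v)
  rify at hk hdeg hcount
  refine max_le ?_ ?_ <;> linarith
end

section
/- Let P ⊂ ℝ^d be a very ample lattice d-simplex with d ≥ 2. Then d_P ≤ ⌊d/2⌋, i.e., for every integer k ≥ ⌊d/2⌋ one has (k+1)P ∩ M = (P ∩ M) + (kP ∩ M). -/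
open Set MeasureTheory
open scoped Pointwise

lemma IsLatticePt.add {n : ℕ} {x y : Fin n → ℝ} (hx : IsLatticePt x) (hy : IsLatticePt y) :
    IsLatticePt (x + y) := fun i => by
  obtain ⟨a, ha⟩ := hx i
  obtain ⟨b, hb⟩ := hy i
  exact ⟨a + b, by simp [ha, hb]⟩

lemma IsLatticePt.sub {n : ℕ} {x y : Fin n → ℝ} (hx : IsLatticePt x) (hy : IsLatticePt y) :
    IsLatticePt (x - y) := fun i => by
  obtain ⟨a, ha⟩ := hx i
  obtain ⟨b, hb⟩ := hy i
  exact ⟨a - b, by simp [ha, hb]⟩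

lemma IsLatticePt.natCast_smul {n : ℕ} {x : Fin n → ℝ} (hx : IsLatticePt x) (k : ℕ) :
    IsLatticePt ((k : ℝ) • x) := fun i => by
  obtain ⟨a, ha⟩ := hx i
  exact ⟨k * a, by simp [ha]⟩

namespace AffineBasis

variable {ι E : Type*} [AddCommGroup E] [Module ℝ E]

lemma coord_eq_linear_add (b : AffineBasis ι ℝ E) (i : ι) (x : E) :
    b.coord i x = (b.coord i).linear x + b.coord i 0 :=
  congrFun (b.coord i).decomp x

/-- Membership in a positive dilate of a simplex, in homogenized barycentric coordinates. -/
lemma mem_smul_convexHull_iff (b : AffineBasis ι ℝ E) {t : ℝ} (ht : 0 < t) (x : E) :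
    x ∈ t • convexHull ℝ (range b) ↔ ∀ i, 0 ≤ (b.coord i).linear x + t * b.coord i 0 := by
  rw [Set.mem_smul_set_iff_inv_smul_mem₀ ht.ne', b.convexHull_eq_nonneg_coord, Set.mem_ofPred_eq]
  refine forall_congr' fun i => ?_
  rw [b.coord_eq_linear_add, map_smul, smul_eq_mul, ← mul_nonneg_iff_of_pos_left ht]
  have : t * (t⁻¹ * (b.coord i).linear x + b.coord i 0) =
      (b.coord i).linear x + t * b.coord i 0 := by
    field_simp
  rw [this]

lemma mem_extremePoints_convexHull (b : AffineBasis ι ℝ E) [Finite ι] (i : ι) :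
    b i ∈ (convexHull ℝ (range b)).extremePoints ℝ := by
  cases nonempty_fintype ι
  rw [mem_extremePoints_iff_left]
  refine ⟨subset_convexHull ℝ _ (mem_range_self i), ?_⟩
  rw [b.convexHull_eq_nonneg_coord]
  rintro x hx y hy ⟨s, t, hs, ht, hst, hxy⟩
  have hzero : ∀ j, j ≠ i → b.coord j x = 0 := fun j hj => by
    have h : b.coord j (s • x + t • y) = s * b.coord j x + t * b.coord j y := by
      simpa using Convex.combo_affine_apply (f := b.coord j) (x := x) (y := y) hst
    rw [hxy, b.coord_apply_ne hj] at h
    have h₁ := mul_nonneg hs.le (hx j)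
    have h₂ := mul_nonneg ht.le (hy j)
    exact (mul_eq_zero.1 (by linarith : s * b.coord j x = 0)).resolve_left hs.ne'
  refine b.ext_elem fun j => ?_
  by_cases hj : j = i
  · subst hj
    have h := b.sum_coord_apply_eq_one x
    rw [Finset.sum_eq_single j (fun l _ hl => hzero l hl) (by simp)] at h
    rw [h, b.coord_apply_eq]
  · rw [hzero j hj, b.coord_apply_ne hj]

end AffineBasis

/-- A sum of at least two lattice points of a simplex based at the vertex `b i`, dominated by `lam`
away from `i`, involves or can be regrouped to involve a lattice point dominated by `lam`,
provided `1 / 2 ≤ lam i`. -/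
lemma exists_latticePt_coord_le {d : ℕ} {ι : Type*} (b : AffineBasis ι ℝ (Fin d → ℝ))
    {i : ι} (hi : IsLatticePt (b i)) {lam : ι → ℝ} (hhalf : 1 / 2 ≤ lam i)
    (l : List (Fin d → ℝ)) (a : Fin d → ℝ)
    (hl : ∀ u ∈ a :: l, u ∈ latticePts (convexHull ℝ (range b)))
    (hne : ∀ j, j ≠ i → ((a :: l).map (b.coord j)).sum ≤ lam j)
    (hsum : 1 < ((a :: l).map fun u => 1 - b.coord i u).sum) :
    ∃ u ∈ latticePts (convexHull ℝ (range b)), ∀ j, b.coord j u ≤ lam j := by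
  have hcoord : ∀ {u}, u ∈ latticePts (convexHull ℝ (range b)) → ∀ j, 0 ≤ b.coord j u := by
    intro u hu
    have := hu.1
    rwa [b.convexHull_eq_nonneg_coord] at this
  induction l generalizing a with
  | nil =>
    have := hcoord (hl a (by simp)) i
    simp at hsum
    linarith
  | cons c l ih =>
    have ha := hl a (by simp)
    have hc := hl c (by simp)
    have hrest : ∀ j, 0 ≤ (l.map (b.coord j)).sum := fun j =>
      List.sum_nonneg fun r hr => by
        obtain ⟨u, hu, rfl⟩ := List.mem_map.1 hr
        exact hcoord (hl u (by simp [hu])) j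
    by_cases hac : 1 ≤ b.coord i a + b.coord i c
    · have hw : ∀ j, b.coord j (a + c - b i) =
          b.coord j a + b.coord j c - b.coord j (b i) := fun j => by
        rw [b.coord_eq_linear_add j (_ - _), b.coord_eq_linear_add j a, b.coord_eq_linear_add j c,
          b.coord_eq_linear_add j (b i), map_sub, map_add]
        ring
      have hwi := hw i
      rw [b.coord_apply_eq] at hwi
      have hwj : ∀ j, j ≠ i → b.coord j (a + c - b i) = b.coord j a + b.coord j c := fun j hj => by
        rw [hw, b.coord_apply_ne hj, sub_zero]
      refine ih (a + c - b i) ?_ ?_ ?_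
      · intro u hu
        rcases List.mem_cons.1 hu with rfl | hu
        · refine ⟨?_, (ha.2.add hc.2).sub hi⟩
          rw [b.convexHull_eq_nonneg_coord]
          intro j
          by_cases hj : j = i
          · subst hj
            linarith
          · rw [hwj j hj]
            exact add_nonneg (hcoord ha j) (hcoord hc j)
        · exact hl u (by simp [hu])
      · intro j hj
        have := hne j hj
        simp only [List.map_cons, List.sum_cons] at this ⊢
        rw [hwj j hj]
        linarith
      · simp only [List.map_cons, List.sum_cons] at hsum ⊢
        linarith
    · rcases le_total (b.coord i a) (b.coord i c) with h | h
      · refine ⟨a, ha, fun j => ?_⟩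
        by_cases hj : j = i
        · subst hj
          linarith
        · have := hne j hj
          have := hrest j
          have := hcoord hc j
          simp only [List.map_cons, List.sum_cons] at *
          linarith
      · refine ⟨c, hc, fun j => ?_⟩
        by_cases hj : j = i
        · subst hj
          linarith
        · have := hne j hj
          have := hrest j
          have := hcoord ha j
          simp only [List.map_cons, List.sum_cons] at *
          linarith

/-- Each lattice point of `(k + 1)P`, with `P` a very ample `d`-simplex and `d < 2 (k + 1)`,
dominates a lattice point of `P` in barycentric coordinates. -/
lemma IsVeryAmple.exists_latticePt_coord_le {d : ℕ}
    (b : AffineBasis (Fin (d + 1)) ℝ (Fin d → ℝ)) (hlat : ∀ i, IsLatticePt (b i))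
    (hva : IsVeryAmple (convexHull ℝ (range b))) {k : ℕ} (hk : 1 ≤ k) (hdk : d < 2 * (k + 1))
    {x : Fin d → ℝ} (hx : x ∈ latticePts (((k : ℝ) + 1) • convexHull ℝ (range b))) :
    ∃ u ∈ latticePts (convexHull ℝ (range b)),
      ∀ j, b.coord j u ≤ (b.coord j).linear x + (k + 1) * b.coord j 0 := by
  set lam : Fin (d + 1) → ℝ := fun j => (b.coord j).linear x + (k + 1) * b.coord j 0 with hlam
  have hk0 : (0 : ℝ) < k + 1 := by positivity
  have hlam0 : ∀ j, 0 ≤ lam j := (b.mem_smul_convexHull_iff hk0 x).1 hx.1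
  by_cases hbig : ∃ i, 1 ≤ lam i
  · obtain ⟨i, hi⟩ := hbig
    refine ⟨b i, ⟨subset_convexHull ℝ _ (mem_range_self i), hlat i⟩, fun j => ?_⟩
    by_cases hj : j = i
    · subst hj
      rwa [b.coord_apply_eq]
    · rw [b.coord_apply_ne hj]
      exact hlam0 j
  push Not at hbig
  have hlamsum : ∑ j, lam j = k + 1 := by
    have h₁ := b.sum_coord_apply_eq_one x
    have h₀ := b.sum_coord_apply_eq_one (0 : Fin d → ℝ)
    simp only [b.coord_eq_linear_add _ x, Finset.sum_add_distrib] at h₁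
    simp only [hlam, Finset.sum_add_distrib, ← Finset.mul_sum, h₀]
    linarith
  obtain ⟨i, hi⟩ : ∃ i, 1 / 2 ≤ lam i := by
    by_contra! h
    have := Finset.sum_lt_sum_of_nonempty (Finset.univ_nonempty) fun j _ => h j
    rw [hlamsum] at this
    simp at this
    have h' : (d : ℝ) + 1 ≤ 2 * (k + 1) := by exact_mod_cast hdk
    linarith
  obtain ⟨m, u, hu, hxu⟩ := hva (b i) (b.mem_extremePoints_convexHull i)
    (x - ((k + 1 : ℕ) : ℝ) • b i) (hx.2.sub ((hlat i).natCast_smul _)) (by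
      obtain ⟨p, hp, hpx⟩ := hx.1
      refine ⟨k + 1, p - b i, ⟨p, hp, rfl⟩, hk0.le, ?_⟩
      rw [← hpx, smul_sub]
      simp)
  have hcoordsum : ∀ j, lam j - (k + 1) * b.coord j (b i) =
      ∑ l, (b.coord j (u l) - b.coord j (b i)) := fun j => by
    have h := congrArg (b.coord j).linear hxu
    simp only [map_sum, map_sub, map_smul, smul_eq_mul] at h
    push_cast at h
    simp only [hlam, b.coord_eq_linear_add j (b i), b.coord_eq_linear_add j (u _),
      add_sub_add_right_eq_sub]
    linarith
  have hsum : 1 < ((List.ofFn u).map fun u => 1 - b.coord i u).sum := by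
    have h := hcoordsum i
    rw [b.coord_apply_eq] at h
    rw [List.map_ofFn, List.sum_ofFn]
    have h' : ∑ l, (1 - b.coord i (u l)) = -∑ l, (b.coord i (u l) - 1) := by
      rw [← Finset.sum_neg_distrib]
      simp
    have h1 : (1 : ℝ) ≤ k := by exact_mod_cast hk
    have := hbig i
    simp only [Function.comp_apply]
    linarith
  have hne : ∀ j, j ≠ i → ((List.ofFn u).map (b.coord j)).sum ≤ lam j := fun j hj => by
    have h := hcoordsum j
    rw [b.coord_apply_ne hj] at h
    rw [List.map_ofFn, List.sum_ofFn]
    simp only [mul_zero, sub_zero] at h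
    exact h.ge
  have hmem : ∀ w ∈ List.ofFn u, w ∈ latticePts (convexHull ℝ (range b)) := fun w hw => by
    obtain ⟨l, rfl⟩ := (List.mem_ofFn' u w).1 hw
    exact hu l
  generalize List.ofFn u = l at hsum hne hmem
  cases l with
  | nil =>
    simp at hsum
    linarith
  | cons a l => exact _root_.exists_latticePt_coord_le b (hlat i) hi l a hmem hne hsum

/-- `d_P ≤ ⌊d/2⌋` for very ample simplices with `d ≥ 2`. -/
theorem stmt13 {d : ℕ} (v : Fin (d + 1) → Fin d → ℝ)
    (hlat : ∀ i, IsLatticePt (v i)) (hind : AffineIndependent ℝ v) (hd : 2 ≤ d)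
    (hva : IsVeryAmple (convexHull ℝ (Set.range v))) :
    dInv (convexHull ℝ (Set.range v)) ≤ d / 2 ∧
      ∀ k : ℕ, d / 2 ≤ k →
        latticePts (((k : ℝ) + 1) • convexHull ℝ (Set.range v)) =
          latticePts (convexHull ℝ (Set.range v)) +
            latticePts ((k : ℝ) • convexHull ℝ (Set.range v)) := by
  have hmain : ∀ k : ℕ, d / 2 ≤ k →
      latticePts (((k : ℝ) + 1) • convexHull ℝ (Set.range v)) =
        latticePts (convexHull ℝ (Set.range v)) +
          latticePts ((k : ℝ) • convexHull ℝ (Set.range v)) := by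
    intro k hk
    have hk1 : 1 ≤ k := by omega
    have hk0 : (0 : ℝ) < k := by exact_mod_cast hk1
    let b : AffineBasis (Fin (d + 1)) ℝ (Fin d → ℝ) :=
      ⟨v, hind, hind.affineSpan_eq_top_iff_card_eq_finrank_add_one.2 (by simp)⟩
    have hbv : (b : Fin (d + 1) → Fin d → ℝ) = v := rfl
    rw [← hbv] at hlat hva ⊢
    apply Set.Subset.antisymm
    · intro x hx
      obtain ⟨u, hu, hux⟩ := hva.exists_latticePt_coord_le b hlat hk1 (by omega) hx
      refine ⟨u, hu, x - u, ⟨(b.mem_smul_convexHull_iff hk0 _).2 fun j => ?_, hx.2.sub hu.2⟩,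
        add_sub_cancel u x⟩
      have := hux j
      rw [b.coord_eq_linear_add] at this
      rw [map_sub]
      linarith
    · rintro _ ⟨u, hu, w, hw, rfl⟩
      refine ⟨?_, hu.2.add hw.2⟩
      rw [add_comm (k : ℝ), (convex_convexHull ℝ _).add_smul zero_le_one hk0.le, one_smul]
      exact Set.add_mem_add hu.1 hw.1
  exact ⟨Nat.sInf_le ⟨by omega, hmain⟩, hmain⟩
end

section
/- For an integer s ≥ 4, let P_s ⊂ ℝ^3 be the convex hull of the eight points (0,0,0), (1,0,0), (0,1,0), (0,0,1), (1,0,1), (0,1,1), (1,1,s), (1,1,s+1). Then P_s is a very ample lattice 3-polytope with d_{P_s} = 2, ν_{P_s} = 2, and k_{P_s} = s − 1; in particular, for every s ≥ 6 one has k_{P_s} > ν_{P_s} + d_{P_s} − 1, so the bound k_P ≤ ν_P + d_P − 1 fails for very ample lattice polytopes that are not simplices. -/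
open Set MeasureTheory
open scoped Pointwise

/-- The polytope of Example 6.1 (Bruns–Gubeladze): the convex hull of the columns of
`[[0,1,0,0,1,0,1,1],[0,0,1,0,0,1,1,1],[0,0,0,1,1,1,s,s+1]]`. -/
def brunsPolytope (s : ℕ) : Set (Fin 3 → ℝ) :=
  convexHull ℝ
    ({![0, 0, 0], ![1, 0, 0], ![0, 1, 0], ![0, 0, 1], ![1, 0, 1], ![0, 1, 1],
      ![1, 1, (s : ℝ)], ![1, 1, (s : ℝ) + 1]} : Set (Fin 3 → ℝ))

/-- The inequalities cutting out the lattice points `(a, b, c)` of the dilate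
`K • brunsPolytope s`. -/
def BrunsIneq (s K a b c : ℤ) : Prop :=
  0 ≤ a ∧ a ≤ K ∧ 0 ≤ b ∧ b ≤ K ∧ 0 ≤ c ∧ s * (a + b - K) ≤ c ∧ c ≤ s * a + K ∧ c ≤ s * b + K

theorem BrunsIneq.add {s K L a b c a' b' c' : ℤ} (h : BrunsIneq s K a b c)
    (h' : BrunsIneq s L a' b' c') : BrunsIneq s (K + L) (a + a') (b + b') (c + c') := by
  obtain ⟨h1, h2, h3, h4, h5, h6, h7, h8⟩ := h
  obtain ⟨g1, g2, g3, g4, g5, g6, g7, g8⟩ := h'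
  refine ⟨?_, ?_, ?_, ?_, ?_, ?_, ?_, ?_⟩ <;> linarith

theorem BrunsIneq.one_cases {s a b c : ℤ} (h : BrunsIneq s 1 a b c) :
    (a = 0 ∨ a = 1) ∧ (b = 0 ∨ b = 1) ∧ (c = s * (a * b) ∨ c = s * (a * b) + 1) := by
  obtain ⟨h1, h2, h3, h4, h5, h6, h7, h8⟩ := h
  have ha : a = 0 ∨ a = 1 := by omega
  have hb : b = 0 ∨ b = 1 := by omega
  refine ⟨ha, hb, ?_⟩
  rcases ha with rfl | rfl <;> rcases hb with rfl | rfl <;> norm_num at * <;> omega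

theorem brunsIneq_one_square {s a b e : ℤ} (hs : 0 ≤ s) (ha : a = 0 ∨ a = 1)
    (hb : b = 0 ∨ b = 1) (he : e = 0 ∨ e = 1) : BrunsIneq s 1 a b (s * (a * b) + e) := by
  unfold BrunsIneq
  rcases ha with rfl | rfl <;> rcases hb with rfl | rfl <;> rcases he with rfl | rfl <;>
    norm_num <;> omega

/-- Dilates of order at least three decompose by splitting off a vertex. -/
theorem BrunsIneq.exists_sub_vertex {s K a b c : ℤ} (hs : 1 ≤ s) (hK : 2 ≤ K)
    (h : BrunsIneq s (K + 1) a b c) :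
    ∃ a' b' c', BrunsIneq s 1 a' b' c' ∧ BrunsIneq s K (a - a') (b - b') (c - c') := by
  obtain ⟨h1, h2, h3, h4, h5, h6, h7, h8⟩ := h
  have key : ∀ a' b' e : ℤ, (a' = 0 ∨ a' = 1) → (b' = 0 ∨ b' = 1) → (e = 0 ∨ e = 1) →
      BrunsIneq s K (a - a') (b - b') (c - (s * (a' * b') + e)) →
      ∃ a' b' c', BrunsIneq s 1 a' b' c' ∧ BrunsIneq s K (a - a') (b - b') (c - c') :=
    fun a' b' e ha hb he hD =>
      ⟨a', b', _, brunsIneq_one_square (by omega) ha hb he, hD⟩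
  -- the shift `e` is `1` as soon as the lower bounds leave room for it
  have pick : ∀ lo hi z : ℤ, lo ≤ z → z ≤ hi + 1 → lo ≤ hi →
      ∃ e : ℤ, (e = 0 ∨ e = 1) ∧ lo ≤ z - e ∧ z - e ≤ hi := by
    intro lo hi z hz1 hz2 hlh
    by_cases hz : z ≤ hi
    · exact ⟨0, Or.inl rfl, by omega, by omega⟩
    · exact ⟨1, Or.inr rfl, by omega, by omega⟩
  have mono : ∀ {p q : ℤ}, p ≤ q → s * p ≤ s * q := fun hpq =>
    mul_le_mul_of_nonneg_left hpq (by omega)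
  rcases lt_trichotomy a b with hab | hab | hab
  · obtain ⟨e, he, he1, he2⟩ := pick (max 0 (s * (a + b - (K + 1)))) (s * a + K) c
      (max_le h5 h6) (by linarith)
      (max_le (by nlinarith) (by linarith [mono (show a + b - (K + 1) ≤ a by omega)]))
    refine key 0 1 e (by simp) (by simp) he ⟨?_, ?_, ?_, ?_, ?_, ?_, ?_, ?_⟩ <;>
      linarith [mono (show a ≤ b - 1 by omega), (le_max_left _ _).trans he1,
        (le_max_right _ _).trans he1]
  · subst hab
    rcases lt_trichotomy (2 * a) (K + 1) with hk | hk | hk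
    · obtain ⟨e, he, he1, he2⟩ := pick 0 (s * a + K) c h5 (by linarith) (by nlinarith)
      refine key 0 0 e (by simp) (by simp) he ⟨?_, ?_, ?_, ?_, ?_, ?_, ?_, ?_⟩ <;>
        linarith [mono (show a + a - K ≤ 0 by omega)]
    · by_cases hc : c ≤ s * (a - 1) + K + 1
      · obtain ⟨e, he, he1, he2⟩ := pick 0 (s * (a - 1) + K) c h5 (by linarith)
          (by nlinarith)
        refine key 1 0 e (by simp) (by simp) he ⟨?_, ?_, ?_, ?_, ?_, ?_, ?_, ?_⟩ <;>
          linarith [mono (show a + a - 1 - K ≤ 0 by omega)]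
      · obtain ⟨e, he, he1, he2⟩ := pick s (s * a + K) c
          (by nlinarith [mono (show 2 ≤ a by omega)]) (by linarith) (by nlinarith)
        have hw : s * (a + a - K) = s := by rw [show a + a - K = 1 by omega, mul_one]
        refine key 0 0 e (by simp) (by simp) he ⟨?_, ?_, ?_, ?_, ?_, ?_, ?_, ?_⟩ <;>
          linarith
    · obtain ⟨e, he, he1, he2⟩ := pick (s * (a + a - (K + 1))) (s * a + K) c h6 (by linarith)
        (by linarith [mono (show a + a - (K + 1) ≤ a by omega)])
      refine key 1 1 e (by simp) (by simp) he ⟨?_, ?_, ?_, ?_, ?_, ?_, ?_, ?_⟩ <;>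
        linarith [mono (show 1 ≤ a + a - (K + 1) by omega)]
  · obtain ⟨e, he, he1, he2⟩ := pick (max 0 (s * (a + b - (K + 1)))) (s * b + K) c
      (max_le h5 h6) (by linarith)
      (max_le (by nlinarith) (by linarith [mono (show a + b - (K + 1) ≤ b by omega)]))
    refine key 1 0 e (by simp) (by simp) he ⟨?_, ?_, ?_, ?_, ?_, ?_, ?_, ?_⟩ <;>
      linarith [mono (show b ≤ a - 1 by omega), (le_max_left _ _).trans he1,
        (le_max_right _ _).trans he1]

theorem mem_brunsPolytope_iff {s : ℕ} (hs : 1 ≤ s) (p : Fin 3 → ℝ) :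
    p ∈ brunsPolytope s ↔ 0 ≤ p 0 ∧ p 0 ≤ 1 ∧ 0 ≤ p 1 ∧ p 1 ≤ 1 ∧ 0 ≤ p 2 ∧
      s * (p 0 + p 1 - 1) ≤ p 2 ∧ p 2 ≤ s * p 0 + 1 ∧ p 2 ≤ s * p 1 + 1 := by
  have hs' : (1 : ℝ) ≤ s := by exact_mod_cast hs
  constructor
  · intro hp
    refine convexHull_min (t := {p : Fin 3 → ℝ | 0 ≤ p 0 ∧ p 0 ≤ 1 ∧ 0 ≤ p 1 ∧ p 1 ≤ 1 ∧
      0 ≤ p 2 ∧ s * (p 0 + p 1 - 1) ≤ p 2 ∧ p 2 ≤ s * p 0 + 1 ∧ p 2 ≤ s * p 1 + 1}) ?_ ?_ hp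
    · intro q hq
      simp only [mem_insert_iff, mem_singleton_iff] at hq
      rcases hq with rfl | rfl | rfl | rfl | rfl | rfl | rfl | rfl <;>
        simp <;> linarith
    · rintro q ⟨h1, h2, h3, h4, h5, h6, h7, h8⟩ r ⟨g1, g2, g3, g4, g5, g6, g7, g8⟩
        u v hu hv huv
      obtain rfl : v = 1 - u := by linarith
      simp only [mem_ofPred_eq, Pi.add_apply, Pi.smul_apply, smul_eq_mul]
      refine ⟨?_, ?_, ?_, ?_, ?_, ?_, ?_, ?_⟩ <;> nlinarith
  · rintro ⟨h1, h2, h3, h4, h5, h6, h7, h8⟩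
    obtain ⟨c, hc0, hc1, hcx, hcy, hz0, hz1⟩ : ∃ c : ℝ, 0 ≤ c ∧ p 0 + p 1 - 1 ≤ c ∧
        c ≤ p 0 ∧ c ≤ p 1 ∧ s * c ≤ p 2 ∧ p 2 ≤ s * c + 1 := by
      have hsp : (0 : ℝ) < s := by linarith
      have e1 : s * ((p 2 - 1) / s) = p 2 - 1 := by field_simp
      have l1 : (p 2 - 1) / s ≤ p 0 := by rw [div_le_iff₀ hsp]; linarith
      have l2 : (p 2 - 1) / s ≤ p 1 := by rw [div_le_iff₀ hsp]; linarith
      refine ⟨max 0 (max (p 0 + p 1 - 1) ((p 2 - 1) / s)), by simp, by simp,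
        max_le h1 (max_le (by linarith) l1), max_le h3 (max_le (by linarith) l2), ?_, ?_⟩
      · rw [mul_max_of_nonneg _ _ hsp.le, mul_max_of_nonneg _ _ hsp.le, e1]
        simp only [mul_zero, max_le_iff]
        exact ⟨h5, h6, by linarith⟩
      · rw [mul_max_of_nonneg _ _ hsp.le, mul_max_of_nonneg _ _ hsp.le, e1]
        have h := (le_max_right ((s : ℝ) * (p 0 + p 1 - 1)) (p 2 - 1)).trans
          (le_max_right ((s : ℝ) * 0) _)
        linarith
    set e := p 2 - s * c with he
    have he1 : 0 ≤ 1 - e := by linarith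
    have he0 : 0 ≤ e := by linarith
    have w0 : 0 ≤ 1 - p 0 - p 1 + c := by linarith
    have w1 : 0 ≤ p 0 - c := by linarith
    have w2 : 0 ≤ p 1 - c := by linarith
    let V : Fin 8 → Fin 3 → ℝ := ![![0, 0, 0], ![1, 0, 0], ![0, 1, 0], ![0, 0, 1], ![1, 0, 1],
      ![0, 1, 1], ![1, 1, (s : ℝ)], ![1, 1, (s : ℝ) + 1]]
    let w : Fin 8 → ℝ := ![(1 - p 0 - p 1 + c) * (1 - e), (p 0 - c) * (1 - e),
      (p 1 - c) * (1 - e), (1 - p 0 - p 1 + c) * e, (p 0 - c) * e, (p 1 - c) * e,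
      c * (1 - e), c * e]
    have hsum : p = ∑ i, w i • V i := by
      ext i
      fin_cases i <;> simp [Fin.sum_univ_eight, w, V] <;> linarith
    rw [hsum]
    refine (convex_convexHull ℝ _).sum_mem (fun i _ => ?_) ?_ (fun i _ => ?_)
    · fin_cases i <;> simp [w] <;> positivity
    · simp [Fin.sum_univ_eight, w]; ring
    · apply subset_convexHull
      fin_cases i <;> simp [V]

theorem mem_latticePts_smul_brunsPolytope {s : ℕ} (hs : 1 ≤ s) {r : ℝ} {K : ℤ}
    (hr : r = K) (hK : 0 < K) (x : Fin 3 → ℝ) :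
    x ∈ latticePts (r • brunsPolytope s) ↔
      ∃ a b c : ℤ, x = ![(a : ℝ), b, c] ∧ BrunsIneq s K a b c := by
  subst hr
  have hK' : (0 : ℝ) < K := by exact_mod_cast hK
  have key : ∀ a b c : ℤ, (![(a : ℝ), b, c] : Fin 3 → ℝ) ∈ (K : ℝ) • brunsPolytope s ↔
      BrunsIneq s K a b c := by
    intro a b c
    rw [mem_smul_set_iff_inv_smul_mem₀ hK'.ne', mem_brunsPolytope_iff hs]
    simp only [Pi.smul_apply, smul_eq_mul, Matrix.cons_val]
    unfold BrunsIneq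
    have e : ∀ z : ℝ, (K : ℝ)⁻¹ * z = z / K := fun z => by ring
    simp only [e]
    have e6 : (s : ℝ) * (a / K + b / K - 1) = s * (a + b - K) / K := by field_simp
    have e7 : ∀ z : ℝ, (s : ℝ) * (z / K) + 1 = (s * z + K) / K := fun z => by field_simp
    rw [e6, e7, e7, div_le_div_iff_of_pos_right hK', div_le_div_iff_of_pos_right hK',
      div_le_div_iff_of_pos_right hK', div_le_one hK', div_le_one hK', le_div_iff₀ hK',
      le_div_iff₀ hK', le_div_iff₀ hK', zero_mul]
    norm_cast
  constructor
  · rintro ⟨hx, hl⟩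
    obtain ⟨a, ha⟩ := hl 0
    obtain ⟨b, hb⟩ := hl 1
    obtain ⟨c, hc⟩ := hl 2
    have hxe : x = ![(a : ℝ), b, c] := by
      ext i; fin_cases i <;> simp [ha, hb, hc]
    exact ⟨a, b, c, hxe, (key a b c).1 (hxe ▸ hx)⟩
  · rintro ⟨a, b, c, rfl, h⟩
    refine ⟨(key a b c).2 h, fun i => ?_⟩
    fin_cases i
    exacts [⟨a, rfl⟩, ⟨b, rfl⟩, ⟨c, rfl⟩]

theorem mem_latticePts_brunsPolytope {s : ℕ} (hs : 1 ≤ s) (x : Fin 3 → ℝ) :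
    x ∈ latticePts (brunsPolytope s) ↔
      ∃ a b c : ℤ, x = ![(a : ℝ), b, c] ∧ BrunsIneq s 1 a b c := by
  rw [← mem_latticePts_smul_brunsPolytope hs (r := 1) (by simp) one_pos, one_smul]

theorem extremePoints_brunsPolytope {s : ℕ} (hs : 1 ≤ s) :
    (brunsPolytope s).extremePoints ℝ = latticePts (brunsPolytope s) := by
  ext x
  constructor
  · intro hx
    refine ⟨hx.1, ?_⟩
    have h := extremePoints_convexHull_subset hx
    simp only [mem_insert_iff, mem_singleton_iff] at h
    have hz : ∀ a b c : ℤ, IsLatticePt (![(a : ℝ), b, c] : Fin 3 → ℝ) := by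
      intro a b c i
      fin_cases i
      exacts [⟨a, rfl⟩, ⟨b, rfl⟩, ⟨c, rfl⟩]
    rcases h with rfl | rfl | rfl | rfl | rfl | rfl | rfl | rfl
    · simpa using hz 0 0 0
    · simpa using hz 1 0 0
    · simpa using hz 0 1 0
    · simpa using hz 0 0 1
    · simpa using hz 1 0 1
    · simpa using hz 0 1 1
    · simpa using hz 1 1 s
    · simpa using hz 1 1 (s + 1)
  · intro hx
    refine ⟨hx.1, ?_⟩
    obtain ⟨a, b, c, rfl, h⟩ := (mem_latticePts_brunsPolytope hs x).1 hx
    rintro q hq r hr ⟨u, v, hu, hv, huv, heq⟩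
    rw [mem_brunsPolytope_iff hs] at hq hr
    obtain ⟨h1, h2, h3, h4, h5, h6, h7, h8⟩ := hq
    obtain ⟨g1, g2, g3, g4, g5, g6, g7, g8⟩ := hr
    have lo : ∀ {l y z : ℝ}, l ≤ y → l ≤ z → u * y + v * z = l → y = l ∧ z = l := by
      intro l y z hy hz he
      have hy' := mul_nonneg hu.le (sub_nonneg.2 hy)
      have hz' := mul_nonneg hv.le (sub_nonneg.2 hz)
      have hsum : u * (y - l) + v * (z - l) = 0 := by linear_combination he - l * huv
      have hy0 := (mul_eq_zero_iff_left hu.ne').1 (by linarith : u * (y - l) = 0)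
      have hz0 := (mul_eq_zero_iff_left hv.ne').1 (by linarith : v * (z - l) = 0)
      exact ⟨by linarith, by linarith⟩
    have hi : ∀ {l y z : ℝ}, y ≤ l → z ≤ l → u * y + v * z = l → y = l ∧ z = l := by
      intro l y z hy hz he
      obtain ⟨hy', hz'⟩ := lo (neg_le_neg hy) (neg_le_neg hz)
        (by linear_combination -he)
      exact ⟨neg_injective hy', neg_injective hz'⟩
    have e0 := congrFun heq 0
    have e1 := congrFun heq 1
    have e2 := congrFun heq 2
    simp only [Pi.add_apply, Pi.smul_apply, smul_eq_mul, Matrix.cons_val] at e0 e1 e2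
    obtain ⟨ha, hb, hc⟩ := h.one_cases
    have q0 : q 0 = a ∧ r 0 = a := by
      rcases ha with rfl | rfl
      · exact lo (by simpa using h1) (by simpa using g1) e0
      · exact hi (by simpa using h2) (by simpa using g2) e0
    have q1 : q 1 = b ∧ r 1 = b := by
      rcases hb with rfl | rfl
      · exact lo (by simpa using h3) (by simpa using g3) e1
      · exact hi (by simpa using h4) (by simpa using g4) e1
    rw [q0.1, q1.1] at h6
    rw [q0.2, q1.2] at g6
    rw [q0.1] at h7
    rw [q0.2] at g7
    rw [q1.1] at h8
    rw [q1.2] at g8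
    have q2 : q 2 = c := by
      rcases hc with rfl | rfl
      · refine (lo ?_ ?_ e2).1 <;> rcases ha with rfl | rfl <;> rcases hb with rfl | rfl <;>
          push_cast at * <;> linarith
      · refine (hi ?_ ?_ e2).1 <;> rcases ha with rfl | rfl <;> rcases hb with rfl | rfl <;>
          push_cast at * <;> linarith
    ext i
    fin_cases i
    exacts [q0.1, q1.1, q2]

theorem interior_brunsPolytope_nonempty {s : ℕ} (hs : 1 ≤ s) :
    (interior (brunsPolytope s)).Nonempty := by
  have hs' : (1 : ℝ) ≤ s := by exact_mod_cast hs
  refine ⟨![1 / 2, 1 / 4, 1 / 2], mem_interior.2 ⟨{p | 0 < p 0 ∧ p 0 < 1 ∧ 0 < p 1 ∧ p 1 < 1 ∧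
    0 < p 2 ∧ s * (p 0 + p 1 - 1) < p 2 ∧ p 2 < s * p 0 + 1 ∧ p 2 < s * p 1 + 1}, ?_, ?_, ?_⟩⟩
  · rintro p ⟨h1, h2, h3, h4, h5, h6, h7, h8⟩
    exact (mem_brunsPolytope_iff hs p).2
      ⟨h1.le, h2.le, h3.le, h4.le, h5.le, h6.le, h7.le, h8.le⟩
  · refine .and ?_ (.and ?_ (.and ?_ (.and ?_ (.and ?_ (.and ?_ (.and ?_ ?_)))))) <;>
      exact isOpen_lt (by fun_prop) (by fun_prop)
  · simp only [mem_ofPred_eq, Matrix.cons_val]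
    refine ⟨?_, ?_, ?_, ?_, ?_, ?_, ?_, ?_⟩ <;> linarith

theorem exists_fin_sum_sub_of_mem_closure {n : ℕ} {S : Set (Fin n → ℝ)} {v x : Fin n → ℝ}
    (hx : x ∈ AddSubmonoid.closure ((fun p => p - v) '' S)) :
    ∃ (m : ℕ) (u : Fin m → Fin n → ℝ), (∀ j, u j ∈ S) ∧ x = ∑ j, (u j - v) := by
  obtain ⟨l, hl, rfl⟩ := AddSubmonoid.exists_list_of_mem_closure hx
  have : ∀ j : Fin l.length, ∃ p ∈ S, p - v = l.get j := fun j => hl _ (l.get_mem j)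
  choose u hu hu' using this
  refine ⟨l.length, u, hu, ?_⟩
  simp_rw [hu']
  simp

theorem isVeryAmple_brunsPolytope {s : ℕ} (hs : 1 ≤ s) : IsVeryAmple (brunsPolytope s) := by
  rintro v hv x hxl ⟨t, _, ⟨p, hp, rfl⟩, ht, hxe⟩
  apply exists_fin_sum_sub_of_mem_closure
  rw [extremePoints_brunsPolytope hs, mem_latticePts_brunsPolytope hs] at hv
  obtain ⟨a, b, c, rfl, hD⟩ := hv
  rw [mem_brunsPolytope_iff hs] at hp
  obtain ⟨h1, h2, h3, h4, h5, h6, h7, h8⟩ := hp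
  obtain ⟨X, hX⟩ := hxl 0
  obtain ⟨Y, hY⟩ := hxl 1
  obtain ⟨Z, hZ⟩ := hxl 2
  have e0 : (X : ℝ) = t * (p 0 - a) := by rw [← hX, hxe]; rfl
  have e1 : (Y : ℝ) = t * (p 1 - b) := by rw [← hY, hxe]; rfl
  have e2 : (Z : ℝ) = t * (p 2 - c) := by rw [← hZ, hxe]; rfl
  have hx : x = ![(X : ℝ), Y, Z] := by
    ext i; fin_cases i <;> simp [hX, hY, hZ]
  have f0 : (s : ℝ) * X = s * (t * (p 0 - a)) := by rw [e0]
  have f1 : (s : ℝ) * Y = s * (t * (p 1 - b)) := by rw [e1]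
  replace h1 := mul_nonneg ht h1
  replace h2 := mul_nonneg ht (sub_nonneg.2 h2)
  replace h3 := mul_nonneg ht h3
  replace h4 := mul_nonneg ht (sub_nonneg.2 h4)
  replace h5 := mul_nonneg ht h5
  replace h6 := mul_nonneg ht (sub_nonneg.2 h6)
  replace h7 := mul_nonneg ht (sub_nonneg.2 h7)
  replace h8 := mul_nonneg ht (sub_nonneg.2 h8)
  clear hxe hxl hX hY hZ
  -- it suffices to write `x` in terms of three generators with the given coefficients
  have key : ∀ (n₁ n₂ n₃ a₁ b₁ e₁ a₂ b₂ e₂ a₃ b₃ e₃ : ℤ), 0 ≤ n₁ → 0 ≤ n₂ → 0 ≤ n₃ →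
      (a₁ = 0 ∨ a₁ = 1) → (b₁ = 0 ∨ b₁ = 1) → (e₁ = 0 ∨ e₁ = 1) →
      (a₂ = 0 ∨ a₂ = 1) → (b₂ = 0 ∨ b₂ = 1) → (e₂ = 0 ∨ e₂ = 1) →
      (a₃ = 0 ∨ a₃ = 1) → (b₃ = 0 ∨ b₃ = 1) → (e₃ = 0 ∨ e₃ = 1) →
      X = n₁ * (a₁ - a) + n₂ * (a₂ - a) + n₃ * (a₃ - a) →
      Y = n₁ * (b₁ - b) + n₂ * (b₂ - b) + n₃ * (b₃ - b) →
      Z = n₁ * (s * (a₁ * b₁) + e₁ - c) + n₂ * (s * (a₂ * b₂) + e₂ - c) +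
        n₃ * (s * (a₃ * b₃) + e₃ - c) →
      x ∈ AddSubmonoid.closure ((fun p => p - ![(a : ℝ), b, c]) ''
        latticePts (brunsPolytope s)) := by
    intro n₁ n₂ n₃ a₁ b₁ e₁ a₂ b₂ e₂ a₃ b₃ e₃ hn₁ hn₂ hn₃ ha₁ hb₁ he₁ ha₂ hb₂ he₂ ha₃ hb₃ he₃
      hX hY hZ
    have gen : ∀ n a' b' e : ℤ, 0 ≤ n → (a' = 0 ∨ a' = 1) → (b' = 0 ∨ b' = 1) →
        (e = 0 ∨ e = 1) →
        (n : ℝ) • (![(a' : ℝ), b', ((s * (a' * b') + e : ℤ) : ℝ)] - ![(a : ℝ), b, c]) ∈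
        AddSubmonoid.closure ((fun p => p - ![(a : ℝ), b, c]) ''
          latticePts (brunsPolytope s)) := by
      intro n a' b' e hn ha hb he
      lift n to ℕ using hn
      rw [Int.cast_natCast, Nat.cast_smul_eq_nsmul]
      refine AddSubmonoid.nsmul_mem _ (AddSubmonoid.subset_closure ?_) n
      exact mem_image_of_mem (fun p => p - ![(a : ℝ), b, c])
        ((mem_latticePts_brunsPolytope hs _).2
          ⟨a', b', _, rfl, brunsIneq_one_square (by positivity) ha hb he⟩)
    have hxs := AddSubmonoid.add_mem _ (AddSubmonoid.add_mem _ (gen n₁ a₁ b₁ e₁ hn₁ ha₁ hb₁ he₁)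
      (gen n₂ a₂ b₂ e₂ hn₂ ha₂ hb₂ he₂)) (gen n₃ a₃ b₃ e₃ hn₃ ha₃ hb₃ he₃)
    convert hxs using 1
    rw [hx, hX, hY, hZ]
    ext i
    fin_cases i <;> simp
  clear hx
  obtain ⟨ha, hb, hc⟩ := hD.one_cases
  clear hD
  have hcast : ∀ {m n : ℤ}, (m : ℝ) ≤ n → m ≤ n := fun h => by exact_mod_cast h
  rcases ha with rfl | rfl <;> rcases hb with rfl | rfl <;> rcases hc with rfl | rfl <;>
    push_cast at e0 e1 e2 f0 f1
  · have k1 : 0 ≤ X := hcast (by push_cast; linarith)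
    have k2 : 0 ≤ Y := hcast (by push_cast; linarith)
    have k3 : 0 ≤ Z := hcast (by push_cast; linarith)
    apply key X Y Z 1 0 0 0 1 0 0 0 1 <;> omega
  · have k1 : 0 ≤ X := hcast (by push_cast; linarith)
    have k2 : 0 ≤ Y := hcast (by push_cast; linarith)
    have k3 : Z ≤ s * X := hcast (by push_cast; linarith)
    have k4 : Z ≤ s * Y := hcast (by push_cast; linarith)
    rcases le_total X Y with hXY | hXY
    · apply key X (Y - X) (s * X - Z) 1 1 1 0 1 1 0 0 0 <;> first | omega | ring
    · apply key Y (X - Y) (s * Y - Z) 1 1 1 1 0 1 0 0 0 <;> first | omega | ring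
  · have k1 : 0 ≤ X := hcast (by push_cast; linarith)
    have k2 : Y ≤ 0 := hcast (by push_cast; linarith)
    have k3 : 0 ≤ Z := hcast (by push_cast; linarith)
    have k4 : s * (X + Y) ≤ Z := hcast (by push_cast; linarith)
    rcases le_total X (-Y) with hXY | hXY
    · apply key X (-Y - X) Z 1 0 0 0 0 0 0 1 1 <;> omega
    · apply key (-Y) (X + Y) (Z - s * (X + Y)) 1 0 0 1 1 0 0 1 1 <;> first | omega | ring
  · have k1 : 0 ≤ X := hcast (by push_cast; linarith)
    have k2 : Y ≤ 0 := hcast (by push_cast; linarith)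
    have k3 : Z ≤ s * X := hcast (by push_cast; linarith)
    apply key X (-Y) (s * X - Z) 1 1 1 0 0 1 0 1 0 <;> first | omega | ring
  · have k1 : X ≤ 0 := hcast (by push_cast; linarith)
    have k2 : 0 ≤ Y := hcast (by push_cast; linarith)
    have k3 : 0 ≤ Z := hcast (by push_cast; linarith)
    have k4 : s * (X + Y) ≤ Z := hcast (by push_cast; linarith)
    rcases le_total Y (-X) with hXY | hXY
    · apply key Y (-X - Y) Z 0 1 0 0 0 0 1 0 1 <;> omega
    · apply key (-X) (X + Y) (Z - s * (X + Y)) 0 1 0 1 1 0 1 0 1 <;> first | omega | ring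
  · have k1 : X ≤ 0 := hcast (by push_cast; linarith)
    have k2 : 0 ≤ Y := hcast (by push_cast; linarith)
    have k3 : Z ≤ s * Y := hcast (by push_cast; linarith)
    apply key Y (-X) (s * Y - Z) 1 1 1 0 0 1 1 0 0 <;> first | omega | ring
  · have k1 : X ≤ 0 := hcast (by push_cast; linarith)
    have k2 : Y ≤ 0 := hcast (by push_cast; linarith)
    have k3 : s * (X + Y) ≤ Z := hcast (by push_cast; linarith)
    apply key (-X) (-Y) (Z - s * (X + Y)) 0 1 0 1 0 0 1 1 1 <;> first | omega | ring
  · have k1 : X ≤ 0 := hcast (by push_cast; linarith)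
    have k2 : Y ≤ 0 := hcast (by push_cast; linarith)
    have k3 : Z ≤ s * X := hcast (by push_cast; linarith)
    have k4 : Z ≤ s * Y := hcast (by push_cast; linarith)
    rcases le_total X Y with hXY | hXY
    · apply key (-Y) (Y - X) (s * X - Z) 0 0 1 0 1 1 1 1 0 <;> first | omega | ring
    · apply key (-X) (X - Y) (s * Y - Z) 0 0 1 1 0 1 1 1 0 <;> first | omega | ring

/-- The condition defining both `dInv` and `nuInv` starts to hold exactly at `2`. -/
theorem sInf_splitting_brunsPolytope {s : ℕ} (hs : 4 ≤ s) :
    sInf {m | 0 < m ∧ ∀ k : ℕ, m ≤ k →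
      latticePts (((k : ℝ) + 1) • brunsPolytope s) =
        latticePts (brunsPolytope s) + latticePts ((k : ℝ) • brunsPolytope s)} = 2 := by
  have hs1 : 1 ≤ s := by omega
  have hmem : ∀ k : ℕ, 1 ≤ k → ∀ x, x ∈ latticePts (brunsPolytope s) +
      latticePts ((k : ℝ) • brunsPolytope s) ↔ ∃ a b c a' b' c' : ℤ, BrunsIneq s 1 a b c ∧
        BrunsIneq s k a' b' c' ∧
        x = ![((a + a' : ℤ) : ℝ), ((b + b' : ℤ) : ℝ), ((c + c' : ℤ) : ℝ)] := by
    intro k hk x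
    simp only [Set.mem_add, mem_latticePts_brunsPolytope hs1,
      mem_latticePts_smul_brunsPolytope hs1 (Int.cast_natCast k).symm (by omega)]
    constructor
    · rintro ⟨_, ⟨a, b, c, rfl, h⟩, _, ⟨a', b', c', rfl, h'⟩, rfl⟩
      exact ⟨a, b, c, a', b', c', h, h', by simp⟩
    · rintro ⟨a, b, c, a', b', c', h, h', rfl⟩
      exact ⟨_, ⟨a, b, c, rfl, h⟩, _, ⟨a', b', c', rfl, h'⟩, by simp⟩
  refine IsLeast.csInf_eq ⟨⟨two_pos, fun k hk => ?_⟩, ?_⟩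
  · ext x
    rw [hmem k (by omega), mem_latticePts_smul_brunsPolytope hs1 (K := k + 1) (by simp)
      (by omega)]
    constructor
    · rintro ⟨a, b, c, rfl, h⟩
      obtain ⟨a', b', c', h1, h2⟩ := h.exists_sub_vertex (by omega) (by omega)
      exact ⟨a', b', c', _, _, _, h1, h2, by simp⟩
    · rintro ⟨a, b, c, a', b', c', h, h', rfl⟩
      exact ⟨_, _, _, rfl, by simpa [add_comm] using h.add h'⟩
  · rintro m ⟨hm, h⟩
    by_contra! hlt
    have h := h 1 (by omega)
    have hx : (![((1 : ℤ) : ℝ), ((1 : ℤ) : ℝ), ((3 : ℤ) : ℝ)] : Fin 3 → ℝ) ∈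
        latticePts ((((1 : ℕ) : ℝ) + 1) • brunsPolytope s) := by
      refine (mem_latticePts_smul_brunsPolytope hs1 (K := 2) (by norm_num) (by omega) _).2
        ⟨1, 1, 3, rfl, ?_⟩
      unfold BrunsIneq
      omega
    rw [h, hmem 1 le_rfl] at hx
    obtain ⟨a, b, c, a', b', c', h1, h2, he⟩ := hx
    have e0 := congrFun he 0
    have e1 := congrFun he 1
    have e2 := congrFun he 2
    simp only [Matrix.cons_val, Int.cast_inj] at e0 e1 e2
    obtain ⟨ha, hb, hc⟩ := h1.one_cases
    obtain ⟨ha', hb', hc'⟩ := BrunsIneq.one_cases (by exact_mod_cast h2)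
    rcases ha with rfl | rfl <;> rcases hb with rfl | rfl <;> rcases ha' with rfl | rfl <;>
      rcases hb' with rfl | rfl <;> omega

/-- Sums of `k` vertices are the points over `(a, b)` whose height lies in one of the intervals
`[s * m, s * m + k]`, where `m` counts the vertices over `(1, 1)`. -/
theorem exists_vertex_sum {s : ℕ} (hs : 1 ≤ s) (k : ℕ) : ∀ a b c m : ℤ, 0 ≤ m → a + b - k ≤ m →
    m ≤ a → m ≤ b → s * m ≤ c → c ≤ s * m + k →
    ∃ u : Fin k → Fin 3 → ℝ, (∀ j, u j ∈ latticePts (brunsPolytope s)) ∧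
      (![(a : ℝ), b, c] : Fin 3 → ℝ) = ∑ j, u j := by
  induction k with
  | zero =>
    intro a b c m h1 h2 h3 h4 h5 h6
    push_cast at *
    obtain rfl : m = a := by omega
    obtain rfl : m = b := by omega
    obtain rfl : m = 0 := by omega
    obtain rfl : c = 0 := by linarith
    refine ⟨Fin.elim0, fun j => j.elim0, ?_⟩
    ext i; fin_cases i <;> simp
  | succ k ih =>
    intro a b c m h1 h2 h3 h4 h5 h6
    push_cast at h2 h6
    have step : ∀ a' b' e : ℤ, (a' = 0 ∨ a' = 1) → (b' = 0 ∨ b' = 1) → (e = 0 ∨ e = 1) →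
        (∃ u : Fin k → Fin 3 → ℝ, (∀ j, u j ∈ latticePts (brunsPolytope s)) ∧
          (![((a - a' : ℤ) : ℝ), ((b - b' : ℤ) : ℝ), ((c - (s * (a' * b') + e) : ℤ) : ℝ)] :
            Fin 3 → ℝ) = ∑ j, u j) →
        ∃ u : Fin (k + 1) → Fin 3 → ℝ, (∀ j, u j ∈ latticePts (brunsPolytope s)) ∧
          (![(a : ℝ), b, c] : Fin 3 → ℝ) = ∑ j, u j := by
      rintro a' b' e ha hb he ⟨u, hu, hsum⟩
      refine ⟨Fin.cons ![(a' : ℝ), b', ((s * (a' * b') + e : ℤ) : ℝ)] u, ?_, ?_⟩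
      · refine Fin.cases ?_ hu
        exact (mem_latticePts_brunsPolytope hs _).2
          ⟨a', b', _, rfl, brunsIneq_one_square (by positivity) ha hb he⟩
      · rw [Fin.sum_univ_succ]
        simp only [Fin.cons_zero, Fin.cons_succ]
        rw [← hsum]
        ext i; fin_cases i <;> simp
    obtain ⟨e, he, he1, he2⟩ : ∃ e : ℤ, (e = 0 ∨ e = 1) ∧ s * m ≤ c - e ∧
        c - e ≤ s * m + k := by
      by_cases hz : c ≤ s * m + k
      · exact ⟨0, Or.inl rfl, by linarith, by linarith⟩
      · exact ⟨1, Or.inr rfl, by linarith, by linarith⟩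
    by_cases hm : 1 ≤ m
    · refine step 1 1 e (by simp) (by simp) he (ih _ _ _ (m - 1) ?_ ?_ ?_ ?_ ?_ ?_) <;> linarith
    by_cases ha : m < a
    · refine step 1 0 e (by simp) (by simp) he (ih _ _ _ m ?_ ?_ ?_ ?_ ?_ ?_) <;> linarith
    by_cases hb : m < b
    · refine step 0 1 e (by simp) (by simp) he (ih _ _ _ m ?_ ?_ ?_ ?_ ?_ ?_) <;> linarith
    · refine step 0 0 e (by simp) (by simp) he (ih _ _ _ m ?_ ?_ ?_ ?_ ?_ ?_) <;> linarith

theorem isKNormal_brunsPolytope {s k : ℕ} (hs : 1 ≤ s) (hk : 1 ≤ k) (hsk : s ≤ k + 1) :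
    IsKNormal (brunsPolytope s) k := by
  intro x hx
  rw [mem_latticePts_smul_brunsPolytope hs (Int.cast_natCast k).symm (by omega)] at hx
  obtain ⟨a, b, c, rfl, h1, h2, h3, h4, h5, h6, h7, h8⟩ := hx
  have hs0 : (0 : ℤ) < s := by omega
  have d1 := Int.mul_ediv_add_emod c s
  have d2 := Int.emod_nonneg c hs0.ne'
  have d3 := Int.emod_lt_of_pos c hs0
  have d4 : 0 ≤ c / s := Int.ediv_nonneg h5 hs0.le
  have d5 : a + b - k ≤ c / s := (Int.le_ediv_iff_mul_le hs0).2 (by linarith)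
  refine exists_vertex_sum hs k a b c (min (c / s) (min a b)) (by omega) (by omega) (by omega)
    (by omega) ?_ ?_
  · have := mul_le_mul_of_nonneg_left (min_le_left (c / (s : ℤ)) (min a b)) hs0.le
    linarith
  · rcases min_choice (c / (s : ℤ)) (min a b) with h | h <;> rw [h]
    · have : (s : ℤ) ≤ k + 1 := by exact_mod_cast hsk
      linarith
    · rcases min_choice a b with h | h <;> rw [h] <;> assumption

theorem not_isKNormal_brunsPolytope {s k : ℕ} (hk : 2 ≤ k) (hsk : k + 2 ≤ s) :
    ¬ IsKNormal (brunsPolytope s) k := by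
  intro h
  have hs : 1 ≤ s := by omega
  obtain ⟨u, hu, hsum⟩ := h ![((1 : ℤ) : ℝ), ((1 : ℤ) : ℝ), ((k + 1 : ℤ) : ℝ)] (by
    refine (mem_latticePts_smul_brunsPolytope hs (Int.cast_natCast k).symm (by omega) _).2
      ⟨1, 1, k + 1, rfl, ?_⟩
    refine ⟨?_, ?_, ?_, ?_, ?_, ?_, ?_, ?_⟩ <;> nlinarith)
  have : ∀ j, ∃ m : ℤ, 0 ≤ m ∧ (m : ℝ) ≤ u j 0 ∧ s * m ≤ u j 2 ∧ u j 2 ≤ s * m + 1 := by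
    intro j
    obtain ⟨a, b, c, hj, hD⟩ := (mem_latticePts_brunsPolytope hs _).1 (hu j)
    obtain ⟨ha, hb, hc⟩ := hD.one_cases
    rw [hj]
    refine ⟨a * b, ?_, ?_, ?_, ?_⟩ <;> rcases ha with rfl | rfl <;>
      rcases hb with rfl | rfl <;> rcases hc with rfl | rfl <;> simp
  choose m hm0 hm1 hm2 hm3 using this
  have e0 := congrFun hsum 0
  have e2 := congrFun hsum 2
  simp only [Finset.sum_apply, Matrix.cons_val] at e0 e2
  have s0 : 0 ≤ ∑ j, m j := Finset.sum_nonneg fun j _ => hm0 j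
  have s1 : ((∑ j, m j : ℤ) : ℝ) ≤ (1 : ℤ) := by
    rw [e0]; push_cast; exact Finset.sum_le_sum fun j _ => hm1 j
  have s2 : ((s * ∑ j, m j : ℤ) : ℝ) ≤ (k + 1 : ℤ) := by
    rw [e2]; push_cast; rw [Finset.mul_sum]; exact Finset.sum_le_sum fun j _ => hm2 j
  have s3 : ((k + 1 : ℤ) : ℝ) ≤ ((s * ∑ j, m j + k : ℤ) : ℝ) := by
    rw [e2]
    refine (Finset.sum_le_sum fun j _ => hm3 j).trans ?_
    simp [Finset.sum_add_distrib, Finset.mul_sum]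
  rw [Int.cast_le] at s1 s2 s3
  generalize ∑ j, m j = M at *
  obtain rfl | rfl : M = 0 ∨ M = 1 := by omega
  all_goals omega

theorem kNormality_brunsPolytope {s : ℕ} (hs : 4 ≤ s) : kNormality (brunsPolytope s) = s - 1 := by
  refine IsLeast.csInf_eq ⟨⟨by omega, fun k hk =>
    isKNormal_brunsPolytope (by omega) (by omega) (by omega)⟩, ?_⟩
  rintro m ⟨hm, h⟩
  by_contra! hlt
  exact not_isKNormal_brunsPolytope (le_max_right m 2) (by omega) (h _ (le_max_left m 2))

/-- for `s ≥ 4` the Bruns–Gubeladze polytope is a very ample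
3-dimensional lattice polytope with `d_P = 2`, `ν_P = 2`, `k_P = s - 1`; in particular
for `s ≥ 6` the bound `k_P ≤ ν_P + d_P - 1` fails. -/
theorem stmt17 (s : ℕ) (hs : 4 ≤ s) :
    IsVeryAmple (brunsPolytope s) ∧
      (interior (brunsPolytope s)).Nonempty ∧
      dInv (brunsPolytope s) = 2 ∧
      nuInv ((brunsPolytope s).extremePoints ℝ) (brunsPolytope s) = 2 ∧
      kNormality (brunsPolytope s) = s - 1 ∧
      (6 ≤ s →
        nuInv ((brunsPolytope s).extremePoints ℝ) (brunsPolytope s) +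
            dInv (brunsPolytope s) - 1 < kNormality (brunsPolytope s)) := by
  have hd := sInf_splitting_brunsPolytope hs
  have hdInv : dInv (brunsPolytope s) = 2 := hd
  have hnuInv : nuInv ((brunsPolytope s).extremePoints ℝ) (brunsPolytope s) = 2 := by
    rw [extremePoints_brunsPolytope (by omega)]; exact hd
  have hk := kNormality_brunsPolytope hs
  exact ⟨isVeryAmple_brunsPolytope (by omega), interior_brunsPolytope_nonempty (by omega),
    hdInv, hnuInv, hk, fun _ => by omega⟩
end
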